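/- arXiv:1003.0040 — 3 statements merged into one kernel-verified Lean document; each statement's English description precedes it below -/
import Mathlib

section
/- Let m ≥ 3 and let v = (v_1,…,v_m)ᵀ, v′ = (v′_1,…,v′_m)ᵀ ∈ V. Then RP(v) = RP(v′) if and only if for every nonempty proper subset I ⊂ [m], the sums ∑_{i∈I} v_i and ∑_{i∈I} v′_i have the same sign (both positive or both negative). In particular, v and v′ lying in the same chamber (i.e., having identical sign patterns of all proper subset sums) yield the same ranking pattern, and different sign patterns yield different ranking patterns. -/
open scoped BigOperators

/-- The chamber `C_{i₁⋯i_m}` of the braid arrangement restricted to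
`H0 = {x : ∑ᵢ xᵢ = 0}`, associated with the permutation `σ` (where `σ k` is the
object ranked in position `k`). -/
def braidChamber {m : ℕ} (σ : Equiv.Perm (Fin m)) :
    Set (EuclideanSpace ℝ (Fin m)) :=
  {x | (∑ i, x i = 0) ∧ ∀ k l : Fin m, k < l → x (σ l) < x (σ k)}

/-- The slicing hyperplane `K_v = {x ∈ H0 : vᵀ x = 1}`. -/
def sliceK {m : ℕ} (v : EuclideanSpace ℝ (Fin m)) :
    Set (EuclideanSpace ℝ (Fin m)) :=
  {x | (∑ i, x i = 0) ∧ ∑ i, v i * x i = 1}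

/-- The set `V` of generic unit directions: `v ∈ H0`, `‖v‖ = 1`, and all sums of
entries of `v` over nonempty proper subsets of `[m]` are nonzero. -/
def genericDirections (m : ℕ) : Set (EuclideanSpace ℝ (Fin m)) :=
  {v | (∑ i, v i = 0) ∧ ‖v‖ = 1 ∧
    ∀ I : Finset (Fin m), I.Nonempty → I ≠ Finset.univ → ∑ i ∈ I, v i ≠ 0}

/-- The ranking pattern of the braid slice by `K_v`: the set of permutations
whose chamber meets `K_v`. -/
def rankingPattern {m : ℕ} (v : EuclideanSpace ℝ (Fin m)) :
    Set (Equiv.Perm (Fin m)) :=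
  {σ | (sliceK v ∩ braidChamber σ).Nonempty}

/-- A permutation belongs to the ranking pattern of `v` as soon as some point strictly decreasing
along it has positive pairing with `v`: centre the point and rescale it. -/
theorem mem_rankingPattern_of_pos {m : ℕ} {v : EuclideanSpace ℝ (Fin m)} (hv : ∑ i, v i = 0)
    {σ : Equiv.Perm (Fin m)} {y : Fin m → ℝ} (hy : ∀ k l : Fin m, k < l → y (σ l) < y (σ k))
    (hpos : 0 < ∑ i, v i * y i) : σ ∈ rankingPattern v := by
  have hm : (m : ℝ) ≠ 0 := by
    rintro h
    obtain rfl : m = 0 := by exact_mod_cast h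
    simp at hpos
  set p := ∑ i, v i * y i with hp
  set c := (∑ i, y i) / m with hc
  have hsum : ∑ i, (y i - c) / p = 0 := by
    rw [← Finset.sum_div, Finset.sum_sub_distrib]
    simp [hc, mul_div_cancel₀ _ hm]
  refine ⟨WithLp.toLp 2 fun i => (y i - c) / p, ⟨hsum, ?_⟩, hsum, fun k l hkl => ?_⟩
  · have h : ∀ i, v i * ((y i - c) / p) = (v i * y i - v i * c) / p := fun i => by ring
    simp only [h]
    rw [← Finset.sum_div, Finset.sum_sub_distrib, ← Finset.sum_mul, hv, zero_mul, sub_zero, ← hp,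
      div_self hpos.ne']
  · have := hy k l hkl
    change (y (σ l) - c) / p < (y (σ k) - c) / p
    gcongr

/-- If `v` has positive sum over an initial segment of `σ`, then `σ` is in its ranking pattern. -/
theorem mem_rankingPattern_of_initial_sum_pos {m : ℕ} {v : EuclideanSpace ℝ (Fin m)}
    (hv : ∑ i, v i = 0) {σ : Equiv.Perm (Fin m)} {I : Finset (Fin m)}
    (hI : ∀ k l : Fin m, k < l → σ l ∈ I → σ k ∈ I) (hpos : 0 < ∑ i ∈ I, v i) :
    σ ∈ rankingPattern v := by
  set s := ∑ i ∈ I, v i with hs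
  set q := ∑ i, v i * ((σ.symm i : ℕ) : ℝ) with hq
  set t := (|q| + 1) / s with ht
  have ht0 : 0 ≤ t := by positivity
  refine mem_rankingPattern_of_pos hv
    (y := fun i => (if i ∈ I then t else 0) - ((σ.symm i : ℕ) : ℝ)) (fun k l hkl => ?_) ?_
  · have hkl' : ((k : ℕ) : ℝ) < (l : ℕ) := by exact_mod_cast hkl
    have := hI k l hkl
    simp only [Equiv.symm_apply_apply]
    split_ifs <;> first | linarith | tauto
  · have : ∑ i, v i * ((if i ∈ I then t else 0) - ((σ.symm i : ℕ) : ℝ)) = s * t - q := by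
      simp only [mul_sub, Finset.sum_sub_distrib, mul_ite, mul_zero, Finset.sum_ite_mem,
        Finset.univ_inter, ← Finset.sum_mul, hs, hq]
    rw [this, ht, mul_div_cancel₀ _ hpos.ne']
    linarith [le_abs_self q]

/-- Summation by parts: if the pairing of `w` with an antitone sequence is positive and `w` has
total sum zero, then some proper initial sum of `w` is positive. -/
theorem exists_sum_range_pos_of_antitone {n : ℕ} {w f : ℕ → ℝ}
    (hf : ∀ i, i + 1 < n → f (i + 1) ≤ f i) (hw : ∑ i ∈ Finset.range n, w i = 0)
    (hpos : 0 < ∑ i ∈ Finset.range n, f i * w i) :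
    ∃ k, 0 < k ∧ k < n ∧ 0 < ∑ i ∈ Finset.range k, w i := by
  by_contra! h
  have hparts := Finset.sum_range_by_parts f w n
  simp only [smul_eq_mul, hw, mul_zero, zero_sub] at hparts
  rw [hparts, neg_pos] at hpos
  refine hpos.not_ge (Finset.sum_nonneg fun i hi => ?_)
  have hi' : i + 1 < n := by have := Finset.mem_range.1 hi; omega
  exact mul_nonneg_of_nonpos_of_nonpos (sub_nonpos.2 (hf i hi')) (h _ i.succ_pos hi')

/-- If `σ` is in the ranking pattern of `v`, then `v` has positive sum over some nonempty proper
initial segment of `σ`. -/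
theorem exists_initial_sum_pos_of_mem_rankingPattern {m : ℕ} {v : EuclideanSpace ℝ (Fin m)}
    (hv : ∑ i, v i = 0) {σ : Equiv.Perm (Fin m)} (hσ : σ ∈ rankingPattern v) :
    ∃ I : Finset (Fin m), I.Nonempty ∧ I ≠ Finset.univ ∧
      (∀ k l : Fin m, k < l → σ l ∈ I → σ k ∈ I) ∧ 0 < ∑ i ∈ I, v i := by
  obtain ⟨x, ⟨-, hx⟩, -, hanti⟩ := hσ
  set w : ℕ → ℝ := fun i => if h : i < m then v (σ ⟨i, h⟩) else 0 with hw
  set f : ℕ → ℝ := fun i => if h : i < m then x (σ ⟨i, h⟩) else 0 with hf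
  have hwval : ∀ i : Fin m, w i = v (σ i) := fun i => by simp [hw]
  have hfval : ∀ i : Fin m, f i = x (σ i) := fun i => by simp [hf]
  obtain ⟨k, hk0, hkm, hk⟩ := exists_sum_range_pos_of_antitone (n := m) (w := w) (f := f)
    (fun i hi => by
      have h := hanti ⟨i, by omega⟩ ⟨i + 1, hi⟩ (by simp)
      simpa [hf, hi, show i < m by omega] using h.le)
    (by
      rw [← Fin.sum_univ_eq_sum_range]
      simp only [hwval]
      rw [Equiv.sum_comp σ (fun i => v i), hv])
    (by
      rw [← Fin.sum_univ_eq_sum_range (fun i => f i * w i)]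
      simp only [hwval, hfval]
      rw [Equiv.sum_comp σ (fun i => x i * v i)]
      simp only [mul_comm (x _), hx, zero_lt_one])
  refine ⟨Finset.univ.filter fun i => (σ.symm i : ℕ) < k, ⟨σ ⟨0, by omega⟩, by simpa⟩,
    fun h => ?_, fun a b hab => ?_, ?_⟩
  · have := h.ge (Finset.mem_univ (σ ⟨k, hkm⟩))
    simp at this
  · have : (a : ℕ) < b := hab
    simp only [Finset.mem_filter, Finset.mem_univ, Equiv.symm_apply_apply, true_and]
    omega
  · convert hk using 1
    rw [Finset.sum_filter, ← Equiv.sum_comp σ]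
    simp only [Equiv.symm_apply_apply, ← hwval]
    rw [Fin.sum_univ_eq_sum_range (fun i => if i < k then w i else 0), ← Finset.sum_filter]
    congr 1
    ext i
    simp only [Finset.mem_filter, Finset.mem_range]
    omega

/-- If `v` has negative sum over `I`, then some permutation having `I` as an initial segment is
not in the ranking pattern of `v`: list `I` first, then its complement, each in increasing order
of the coordinates of `v`, and apply Chebyshev's sum inequality to both blocks. -/
theorem exists_notMem_rankingPattern_of_sum_neg {m : ℕ} {v : EuclideanSpace ℝ (Fin m)}
    (hv : ∑ i, v i = 0) {I : Finset (Fin m)} (hneg : ∑ i ∈ I, v i < 0) :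
    ∃ σ : Equiv.Perm (Fin m), (∀ k l : Fin m, k < l → σ l ∈ I → σ k ∈ I) ∧
      σ ∉ rankingPattern v := by
  let key : Fin m → ℕ ×ₗ ℝ := fun i => toLex (if i ∈ I then 0 else 1, v i)
  have hmono : Monotone (key ∘ Tuple.sort key) := Tuple.monotone_sort key
  refine ⟨Tuple.sort key, fun k l hkl hl => ?_, ?_⟩
  · by_contra hk
    have h := hmono hkl.le
    simp [key, Prod.Lex.toLex_le_toLex, hl, hk] at h
  · rintro ⟨x, ⟨hx0, hx1⟩, -, hanti⟩
    have hlt : ∀ i j, key i < key j → x j < x i := fun i j hij => by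
      obtain ⟨a, rfl⟩ := (Tuple.sort key).surjective i
      obtain ⟨b, rfl⟩ := (Tuple.sort key).surjective j
      exact hanti a b (lt_of_not_ge fun hba => (hmono hba).not_gt hij)
    have hI : AntivaryOn v x I := fun i hi j hj hij => by
      by_contra! h
      refine hij.not_gt (hlt i j ?_)
      simp_all [key, Prod.Lex.toLex_lt_toLex]
    have hJ : AntivaryOn v x (Iᶜ : Finset (Fin m)) := fun i hi j hj hij => by
      by_contra! h
      refine hij.not_gt (hlt i j ?_)
      simp_all [key, Prod.Lex.toLex_lt_toLex]
    have hIJ : ∀ i ∈ I, ∀ j ∈ Iᶜ, x j < x i := fun i hi j hj => hlt i j <| by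
      simp_all [key, Prod.Lex.toLex_lt_toLex]
    have hvsplit := Finset.sum_add_sum_compl I (fun i => v i)
    have hxsplit := Finset.sum_add_sum_compl I (fun i => x i)
    have hvxsplit := Finset.sum_add_sum_compl I (fun i => v i * x i)
    have hX : 0 ≤ ∑ i ∈ I, x i := by
      by_contra! h
      obtain ⟨i, hi, hi0⟩ : ∃ i ∈ I, x i < 0 := by
        by_contra! h'
        exact h.not_ge (Finset.sum_nonneg h')
      obtain ⟨j, hj, hj0⟩ : ∃ j ∈ Iᶜ, 0 < x j := by
        by_contra! h'
        linarith [Finset.sum_nonpos h']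
      linarith [hIJ i hi j hj]
    have hcI := hI.card_mul_sum_le_sum_mul_sum
    have hcJ := hJ.card_mul_sum_le_sum_mul_sum
    have hcardI : (0 : ℝ) < I.card := by
      rw [Nat.cast_pos, Finset.card_pos, Finset.nonempty_iff_ne_empty]
      rintro rfl
      simp at hneg
    have hcardJ : (0 : ℝ) < Iᶜ.card := by
      rw [Nat.cast_pos, Finset.card_pos, Finset.nonempty_iff_ne_empty]
      intro h
      rw [h, Finset.sum_empty] at hvsplit
      linarith
    have hle : (∑ i ∈ I, v i) * ∑ i ∈ I, x i ≤ 0 := mul_nonpos_of_nonpos_of_nonneg hneg.le hX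
    have hle' : (∑ i ∈ Iᶜ, v i) * ∑ i ∈ Iᶜ, x i ≤ 0 :=
      mul_nonpos_of_nonneg_of_nonpos (by linarith) (by linarith)
    have h1 : ∑ i ∈ I, v i * x i ≤ 0 := nonpos_of_mul_nonpos_right (hcI.trans hle) hcardI
    have h2 : ∑ i ∈ Iᶜ, v i * x i ≤ 0 := nonpos_of_mul_nonpos_right (hcJ.trans hle') hcardJ
    linarith

/-- Inclusion of ranking patterns forces positivity of subset sums to be inherited. -/
theorem sum_pos_of_rankingPattern_subset {m : ℕ} {v v' : EuclideanSpace ℝ (Fin m)}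
    (hv : ∑ i, v i = 0) (hv' : ∑ i, v' i = 0) (h : rankingPattern v ⊆ rankingPattern v')
    {I : Finset (Fin m)} (hne : ∑ i ∈ I, v' i ≠ 0) (hpos : 0 < ∑ i ∈ I, v i) :
    0 < ∑ i ∈ I, v' i := by
  by_contra! hle
  obtain ⟨σ, hσ, hσv'⟩ := exists_notMem_rankingPattern_of_sum_neg hv' (hle.lt_of_ne hne)
  exact hσv' (h (mem_rankingPattern_of_initial_sum_pos hv hσ hpos))

/-- If positivity of proper subset sums passes from `v` to `v'`, the ranking pattern of `v` is
contained in that of `v'`. -/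
theorem rankingPattern_subset_of_sum_pos {m : ℕ} {v v' : EuclideanSpace ℝ (Fin m)}
    (hv : ∑ i, v i = 0) (hv' : ∑ i, v' i = 0)
    (h : ∀ I : Finset (Fin m), I.Nonempty → I ≠ Finset.univ →
      0 < ∑ i ∈ I, v i → 0 < ∑ i ∈ I, v' i) :
    rankingPattern v ⊆ rankingPattern v' := fun _ hσ => by
  obtain ⟨I, hI, hI', hinit, hpos⟩ := exists_initial_sum_pos_of_mem_rankingPattern hv hσ
  exact mem_rankingPattern_of_initial_sum_pos hv' hinit (h I hI hI' hpos)

/-- Proposition 3.2: for `v, v′ ∈ V`, `RP(v) = RP(v′)` iff for every nonempty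
proper subset `I ⊂ [m]` the subset sums `∑_{i∈I} vᵢ` and `∑_{i∈I} v′ᵢ` have the
same sign. -/
theorem rankingPattern_eq_iff {m : ℕ} (hm : 3 ≤ m)
    (v v' : EuclideanSpace ℝ (Fin m))
    (hv : v ∈ genericDirections m) (hv' : v' ∈ genericDirections m) :
    rankingPattern v = rankingPattern v' ↔
      ∀ I : Finset (Fin m), I.Nonempty → I ≠ Finset.univ →
        (0 < ∑ i ∈ I, v i ↔ 0 < ∑ i ∈ I, v' i) := by
  obtain ⟨hv0, -, hvne⟩ := hv
  obtain ⟨hv0', -, hvne'⟩ := hv'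
  refine ⟨fun h I hI hI' => ⟨?_, ?_⟩, fun h => Set.Subset.antisymm ?_ ?_⟩
  · exact sum_pos_of_rankingPattern_subset hv0 hv0' h.subset (hvne' I hI hI')
  · exact sum_pos_of_rankingPattern_subset hv0' hv0 h.superset (hvne I hI hI')
  · exact rankingPattern_subset_of_sum_pos hv0 hv0' fun I hI hI' => (h I hI hI').1
  · exact rankingPattern_subset_of_sum_pos hv0' hv0 fun I hI hI' => (h I hI hI').2
end

section
/- Let m ≥ 3 and let v ∈ V have exactly one positive entry (so its other m−1 entries are negative). Then RP(v) can be realized as the ranking pattern of an unfolding model of codimension one, i.e., there exist generic μ_1,…,μ_m ∈ ℝ^{m−2} with RP(v) = RP^UF(μ_1,…,μ_m); but RP(−v) cannot be so realized: there exist no generic μ′_1,…,μ′_m ∈ ℝ^{m−2} with RP(−v) = RP^UF(μ′_1,…,μ′_m). -/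
open scoped BigOperators

/-- Condition (A) for `m` points in a real vector space, with `N` edges. -/
def ConditionA {m : ℕ} (N : ℕ) {E : Type*} [AddCommGroup E] [Module ℝ E]
    (ν : Fin m → E) : Prop :=
  ∀ e : Fin N → Fin m × Fin m,
    (∀ k, (e k).1 ≠ (e k).2) →
    Function.Injective (fun k => s((e k).1, (e k).2)) →
    ((SimpleGraph.fromEdgeSet
        (Set.range fun k => s((e k).1, (e k).2))).IsAcyclic ↔
      LinearIndependent ℝ fun k => ν (e k).1 - ν (e k).2)

/-- Genericity of `μ₁,…,μ_m ∈ ℝ^{m-2}` : condition (A1) and condition (A2) for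
the lifted points `(μⱼ, ‖μⱼ‖²)`. -/
def Generic {m : ℕ} (μ : Fin m → EuclideanSpace ℝ (Fin (m - 2))) : Prop :=
  ConditionA (m - 2) μ ∧
    ConditionA (m - 1)
      (fun j => (μ j, ‖μ j‖ ^ 2) :
        Fin m → EuclideanSpace ℝ (Fin (m - 2)) × ℝ)

/-- The ranking pattern of the unfolding model with ideal objects `μ₁,…,μ_m`. -/
def rankingPatternUF {m n : ℕ} (μ : Fin m → EuclideanSpace ℝ (Fin n)) :
    Set (Equiv.Perm (Fin m)) :=
  {σ | ∃ y : EuclideanSpace ℝ (Fin n),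
    ∀ k l : Fin m, k < l → ‖y - μ (σ k)‖ < ‖y - μ (σ l)‖}

/-- The coefficient vector `∑ₖ cₖ (δ_{aₖ} - δ_{bₖ})` of a weighted family of directed edges
`eₖ = (aₖ, bₖ)`. -/
def edgeCombination {ι κ : Type*} [Fintype κ] [DecidableEq ι] (e : κ → ι × ι) (c : κ → ℝ) :
    ι → ℝ :=
  ∑ k, c k • (Pi.single (e k).1 1 - Pi.single (e k).2 1)

section Graph

variable {ι κ : Type*} [Fintype ι] [Fintype κ] [DecidableEq ι] {e : κ → ι × ι}

theorem sum_edgeCombination_smul {E : Type*} [AddCommGroup E] [Module ℝ E]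
    (e : κ → ι × ι) (c : κ → ℝ) (ν : ι → E) :
    ∑ i, edgeCombination e c i • ν i = ∑ k, c k • (ν (e k).1 - ν (e k).2) := by
  rw [← Fintype.linearCombination_apply ℝ ν, edgeCombination, map_sum]
  simp [Fintype.linearCombination_apply_single]

theorem sum_edgeCombination_mul (e : κ → ι × ι) (c : κ → ℝ) (h : ι → ℝ) :
    ∑ i, edgeCombination e c i * h i = ∑ k, c k * (h (e k).1 - h (e k).2) := by
  simpa using sum_edgeCombination_smul e c h

theorem isAcyclic_of_linearIndependent {ι κ : Type*} {e : κ → ι × ι} {E : Type*}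
    [AddCommGroup E] [Module ℝ E] {ν : ι → E}
    (hlin : LinearIndependent ℝ fun k => ν (e k).1 - ν (e k).2) :
    (SimpleGraph.fromEdgeSet (Set.range fun k => s((e k).1, (e k).2))).IsAcyclic := by
  rw [SimpleGraph.isAcyclic_iff_forall_isBridge]
  intro x hx
  obtain ⟨⟨k, rfl⟩, -⟩ := (SimpleGraph.edgeSet_fromEdgeSet _).subset hx
  refine SimpleGraph.isBridge_iff.2 fun hreach => linearIndependent_iff_notMem_span.1 hlin k ?_
  have hspan : ∀ u w,
      ((SimpleGraph.fromEdgeSet (Set.range fun k => s((e k).1, (e k).2))).deleteEdges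
        {s((e k).1, (e k).2)}).Walk u w →
      ν u - ν w ∈ Submodule.span ℝ
        ((fun k => ν (e k).1 - ν (e k).2) '' (Set.univ \ {k})) := by
    intro u w p
    induction p with
    | nil => simp
    | @cons u z w h p ih =>
      rw [← sub_add_sub_cancel (ν u) (ν z) (ν w)]
      refine add_mem ?_ ih
      rw [SimpleGraph.deleteEdges_adj, SimpleGraph.fromEdgeSet_adj] at h
      obtain ⟨⟨⟨l, hl⟩, -⟩, hlk⟩ := h
      have hne : l ≠ k := by
        rintro rfl
        exact hlk hl.symm
      have hmem : ν (e l).1 - ν (e l).2 ∈ Submodule.span ℝ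
          ((fun k => ν (e k).1 - ν (e k).2) '' (Set.univ \ {k})) :=
        Submodule.subset_span ⟨l, by simpa using hne, rfl⟩
      rcases Sym2.eq_iff.1 hl with ⟨rfl, rfl⟩ | ⟨rfl, rfl⟩
      · exact hmem
      · rw [← neg_sub]
        exact neg_mem hmem
  exact hreach.elim (hspan _ _)

theorem eq_zero_of_edgeCombination_eq_zero
    (hne : ∀ k, (e k).1 ≠ (e k).2) (hinj : Function.Injective fun k => s((e k).1, (e k).2))
    (hac : (SimpleGraph.fromEdgeSet (Set.range fun k => s((e k).1, (e k).2))).IsAcyclic)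
    {c : κ → ℝ} (hc : edgeCombination e c = 0) (k : κ) : c k = 0 := by
  classical
  set G := SimpleGraph.fromEdgeSet (Set.range fun k => s((e k).1, (e k).2)) with hG
  have hbr : G.IsBridge s((e k).1, (e k).2) :=
    SimpleGraph.isAcyclic_iff_forall_isBridge.1 hac
      ((SimpleGraph.edgeSet_fromEdgeSet _).superset ⟨⟨k, rfl⟩, by simpa using hne k⟩)
  rw [SimpleGraph.isBridge_iff] at hbr
  set G' := G.deleteEdges {s((e k).1, (e k).2)} with hG'
  have hsum := sum_edgeCombination_mul e c fun i => if G'.Reachable (e k).1 i then 1 else 0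
  rw [hc, Finset.sum_eq_single k] at hsum
  · simpa [hbr] using hsum.symm
  · intro l _ hl
    have hadj : G'.Adj (e l).1 (e l).2 := by
      simp only [hG', hG, SimpleGraph.deleteEdges_adj, SimpleGraph.fromEdgeSet_adj]
      exact ⟨⟨⟨l, rfl⟩, hne l⟩, fun h => hl (hinj h)⟩
    have hiff : G'.Reachable (e k).1 (e l).1 ↔ G'.Reachable (e k).1 (e l).2 :=
      ⟨fun h => h.trans hadj.reachable, fun h => h.trans hadj.reachable.symm⟩
    simp [hiff]
  · simp

/-- Too few edges leave a proper union of components, over which every combination of the edges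
sums to zero. -/
theorem exists_sum_edgeCombination_eq_zero [Nonempty ι]
    (hne : ∀ k, (e k).1 ≠ (e k).2) (hcard : Fintype.card κ + 1 < Fintype.card ι) :
    ∃ S : Finset ι, S.Nonempty ∧ S ≠ Finset.univ ∧
      ∀ c : κ → ℝ, ∑ i ∈ S, edgeCombination e c i = 0 := by
  classical
  set G := SimpleGraph.fromEdgeSet (Set.range fun k => s((e k).1, (e k).2)) with hG
  have hnot : ¬ G.Preconnected := by
    intro hpre
    have h1 := (SimpleGraph.Connected.mk hpre).card_vert_le_card_edgeSet_add_one
    have h2 : Nat.card G.edgeSet ≤ Fintype.card κ := by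
      calc Nat.card G.edgeSet ≤ Nat.card (Set.range fun k => s((e k).1, (e k).2)) :=
            Nat.card_mono (Set.toFinite _) (by simp [hG])
        _ ≤ Nat.card κ := Finite.card_range_le _
        _ = Fintype.card κ := Nat.card_eq_fintype_card
    rw [Nat.card_eq_fintype_card] at h1
    omega
  simp only [SimpleGraph.Preconnected, not_forall] at hnot
  obtain ⟨u, w, huw⟩ := hnot
  refine ⟨Finset.univ.filter fun i => G.Reachable u i, ⟨u, by simp⟩, fun h => huw ?_, fun c => ?_⟩
  · simpa using h.ge (Finset.mem_univ w)
  · have hsum := sum_edgeCombination_mul e c fun i => if G.Reachable u i then 1 else 0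
    rw [Finset.sum_filter]
    simp only [mul_ite, mul_one, mul_zero] at hsum
    rw [hsum]
    refine Finset.sum_eq_zero fun l _ => ?_
    have hadj : G.Adj (e l).1 (e l).2 := by
      rw [hG, SimpleGraph.fromEdgeSet_adj]
      exact ⟨⟨l, rfl⟩, hne l⟩
    have hiff : G.Reachable u (e l).1 ↔ G.Reachable u (e l).2 :=
      ⟨fun h => h.trans hadj.reachable, fun h => h.trans hadj.reachable.symm⟩
    simp [hiff]

end Graph

theorem conditionA_of_edgeCombination {m N : ℕ} {E : Type*} [AddCommGroup E] [Module ℝ E]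
    {ν : Fin m → E}
    (h : ∀ e : Fin N → Fin m × Fin m, (∀ k, (e k).1 ≠ (e k).2) → ∀ c : Fin N → ℝ,
      ∑ i, edgeCombination e c i • ν i = 0 → edgeCombination e c = 0) :
    ConditionA N ν := by
  refine fun e hne hinj => ⟨fun hac => ?_, isAcyclic_of_linearIndependent⟩
  refine Fintype.linearIndependent_iff.2 fun c hc => ?_
  exact eq_zero_of_edgeCombination_eq_zero hne hinj hac
    (h e hne c (by rw [sum_edgeCombination_smul, hc]))

theorem mem_rankingPattern_iff {m : ℕ} (u : EuclideanSpace ℝ (Fin m)) (hu : ∑ i, u i = 0)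
    (σ : Equiv.Perm (Fin m)) :
    σ ∈ rankingPattern u ↔
      ∃ x : Fin m → ℝ, (∀ k l, k < l → x (σ l) < x (σ k)) ∧ 0 < ∑ i, u i * x i := by
  constructor
  · rintro ⟨x, ⟨-, hx⟩, -, hσ⟩
    exact ⟨x, hσ, by simp [hx]⟩
  · rintro ⟨x, hσ, hpos⟩
    have hm : (m : ℝ) ≠ 0 := by
      rintro h
      obtain rfl : m = 0 := by exact_mod_cast h
      simp at hpos
    set p := ∑ i, u i * x i
    set a := (∑ i, x i) / m
    have hsum : ∑ i, p⁻¹ * (x i - a) = 0 := by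
      rw [← Finset.mul_sum, Finset.sum_sub_distrib]
      simp [a, mul_div_cancel₀ _ hm]
    refine ⟨WithLp.toLp 2 fun i => p⁻¹ * (x i - a), ⟨hsum, ?_⟩, hsum, fun k l hkl => ?_⟩
    · calc ∑ i, u i * (p⁻¹ * (x i - a)) = p⁻¹ * (p - (∑ i, u i) * a) := by
            rw [Finset.sum_mul, ← Finset.sum_sub_distrib, Finset.mul_sum]
            exact Finset.sum_congr rfl fun i _ => by ring
        _ = 1 := by rw [hu]; field_simp; ring
    · have := hσ k l hkl
      have := inv_pos.2 hpos
      simp only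
      gcongr

theorem sum_mul_eq_sum_mul_sub {ι : Type*} [Fintype ι] {u : ι → ℝ} (hu : ∑ i, u i = 0)
    (x : ι → ℝ) (t : ℝ) : ∑ i, u i * x i = ∑ i, u i * (x i - t) := by
  simp [mul_sub, Finset.sum_sub_distrib, ← Finset.sum_mul, hu]

theorem rankingPattern_nonempty_of_unique_neg {m : ℕ} (u : EuclideanSpace ℝ (Fin m)) (hm : 2 ≤ m)
    (hu : ∑ i, u i = 0) (i₀ : Fin m) (hpos : ∀ i ≠ i₀, 0 < u i) : (rankingPattern u).Nonempty := by
  have : NeZero m := ⟨by omega⟩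
  let σ : Equiv.Perm (Fin m) := Equiv.swap (Fin.rev 0) i₀
  refine ⟨σ, (mem_rankingPattern_iff u hu σ).2 ⟨fun i => -((σ.symm i : ℕ) : ℝ), fun k l h => ?_, ?_⟩⟩
  · simpa using h
  · have hlast : ∀ i, (σ.symm i : ℕ) ≤ σ.symm i₀ := fun i => by
      have : σ.symm i₀ = Fin.rev 0 := by simp [σ]
      rw [this, Fin.val_rev, Fin.val_zero]
      omega
    have hlt : ∀ i ≠ i₀, ((σ.symm i : ℕ) : ℝ) < (σ.symm i₀ : ℕ) := fun i hi =>
      Nat.cast_lt.2 (lt_of_le_of_ne (hlast i) fun h => hi (σ.symm.injective (Fin.ext h)))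
    have : Nontrivial (Fin m) := Fin.nontrivial_iff_two_le.2 hm
    obtain ⟨j, hj⟩ := exists_ne i₀
    rw [sum_mul_eq_sum_mul_sub hu _ (-((σ.symm i₀ : ℕ) : ℝ))]
    have hterm : ∀ i ≠ i₀, 0 < u i * (-((σ.symm i : ℕ) : ℝ) - -((σ.symm i₀ : ℕ) : ℝ)) :=
      fun i hi => mul_pos (hpos i hi) (by linarith [hlt i hi])
    refine Finset.sum_pos' (fun i _ => ?_) ⟨j, Finset.mem_univ _, hterm j hj⟩
    obtain rfl | hi := eq_or_ne i i₀
    · simp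
    · exact (hterm i hi).le

theorem apply_ne_of_mem_rankingPattern {m : ℕ} (u : EuclideanSpace ℝ (Fin m))
    (hu : ∑ i, u i = 0) (i₀ : Fin m) (hpos : ∀ i ≠ i₀, 0 < u i)
    {σ : Equiv.Perm (Fin m)} (hσ : σ ∈ rankingPattern u) {k : Fin m} (hk : ∀ l, k ≤ l) :
    σ k ≠ i₀ := by
  rintro rfl
  obtain ⟨x, hx, hlt⟩ := (mem_rankingPattern_iff u hu σ).1 hσ
  rw [sum_mul_eq_sum_mul_sub hu x (x (σ k))] at hlt
  refine hlt.not_ge (Finset.sum_nonpos fun i _ => ?_)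
  obtain rfl | hi := eq_or_ne i (σ k)
  · simp
  · obtain ⟨l, rfl⟩ := σ.surjective i
    have hkl : k < l := lt_of_le_of_ne (hk l) (by rintro rfl; exact hi rfl)
    exact mul_nonpos_of_nonneg_of_nonpos (hpos _ hi).le (sub_nonpos.2 (hx k l hkl).le)

/-- If an unfolding model has any admissible ranking, every object is ranked first by some
admissible ranking. -/
theorem exists_mem_rankingPatternUF_apply_eq {m n : ℕ} (μ : Fin m → EuclideanSpace ℝ (Fin n))
    (hne : (rankingPatternUF μ).Nonempty) (i₀ : Fin m) :
    ∃ σ ∈ rankingPatternUF μ, ∃ k, (∀ l, k ≤ l) ∧ σ k = i₀ := by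
  have : NeZero m := ⟨by rintro rfl; exact i₀.elim0⟩
  obtain ⟨τ, y₀, hy₀⟩ := hne
  have hinj₀ : ∀ i j, i ≠ j → ‖y₀ - μ i‖ ≠ ‖y₀ - μ j‖ := by
    intro i j hij
    obtain ⟨k, rfl⟩ := τ.surjective i
    obtain ⟨l, rfl⟩ := τ.surjective j
    rcases lt_or_gt_of_ne (fun h : k = l => hij (h ▸ rfl)) with h | h
    exacts [(hy₀ k l h).ne, (hy₀ l k h).ne']
  let y : ℝ → EuclideanSpace ℝ (Fin n) := fun t => μ i₀ + t • (y₀ - μ i₀)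
  have hdist : ∀ t i, ‖y t - μ i‖ ^ 2 =
      t ^ 2 * ‖y₀ - μ i₀‖ ^ 2 + (1 - t) * ‖μ i₀ - μ i‖ ^ 2
        + t * (‖y₀ - μ i‖ ^ 2 - ‖y₀ - μ i₀‖ ^ 2) := by
    intro t i
    have h1 : y t - μ i = (μ i₀ - μ i) + t • (y₀ - μ i₀) := by simp only [y]; abel
    have h2 : y₀ - μ i = (μ i₀ - μ i) + (y₀ - μ i₀) := by abel
    rw [h1, h2, norm_add_sq_real, norm_add_sq_real, norm_smul, inner_smul_right, mul_pow,
      Real.norm_eq_abs, sq_abs]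
    ring
  have hev : ∀ i j, i ≠ j → ∀ᶠ t in nhdsWithin (0 : ℝ) (Set.Ioi 0), ‖y t - μ i‖ ≠ ‖y t - μ j‖ := by
    intro i j hij
    have hcont : Continuous fun t => ‖y t - μ i‖ - ‖y t - μ j‖ := by fun_prop
    by_cases h0 : ‖μ i₀ - μ i‖ = ‖μ i₀ - μ j‖
    · filter_upwards [self_mem_nhdsWithin] with t ht h
      have h1 := hdist t i
      rw [h, hdist t j, h0] at h1
      have h2 := mul_left_cancel₀ (ne_of_gt ht) (add_left_cancel h1)
      refine hinj₀ i j hij ((sq_eq_sq₀ (norm_nonneg _) (norm_nonneg _)).1 ?_)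
      linarith
    · have hne : ‖y 0 - μ i‖ - ‖y 0 - μ j‖ ≠ 0 := by simpa [y, sub_eq_zero] using h0
      filter_upwards [nhdsWithin_le_nhds (hcont.continuousAt.eventually_ne hne)] with t ht
      exact sub_ne_zero.1 ht
  have hfirst : ∀ j, i₀ ≠ j → ∀ᶠ t in nhdsWithin (0 : ℝ) (Set.Ioi 0),
      ‖y t - μ i₀‖ < ‖y t - μ j‖ := by
    intro j hj
    have hμ : μ i₀ ≠ μ j := fun h => hinj₀ _ _ hj (by rw [h])
    have hcont : ∀ i, ContinuousAt (fun t => ‖y t - μ i‖) 0 := fun i => by fun_prop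
    exact nhdsWithin_le_nhds ((hcont i₀).eventually_lt (hcont j)
      (by simpa [y, sub_eq_zero] using hμ))
  obtain ⟨t, ht, htfirst⟩ := ((Filter.eventually_all.2 fun i => Filter.eventually_all.2 fun j =>
    Filter.eventually_imp_distrib_left.2 (hev i j)).and
    (Filter.eventually_all.2 fun j => Filter.eventually_imp_distrib_left.2 (hfirst j))).exists
  let f : Fin m → ℝ := fun i => ‖y t - μ i‖
  have hf : Function.Injective f := fun i j h => by_contra fun hij => ht i j hij h
  have hmono : StrictMono (f ∘ Tuple.sort f) :=
    (Tuple.monotone_sort f).strictMono_of_injective (hf.comp (Tuple.sort f).injective)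
  refine ⟨Tuple.sort f, ⟨y t, fun k l h => hmono h⟩, 0, fun l => Fin.zero_le _, ?_⟩
  by_contra h
  obtain ⟨l, hl⟩ := (Tuple.sort f).surjective i₀
  have h1 : f i₀ < f (Tuple.sort f 0) := htfirst _ (Ne.symm h)
  have h2 : f (Tuple.sort f 0) ≤ f (Tuple.sort f l) := hmono.monotone (Fin.zero_le _)
  rw [hl] at h2
  exact h1.not_ge h2

/-- Points whose linear relations are spanned by `w` and the vanishing of the `i₀`-th point. -/
theorem exists_points_of_relation {m : ℕ} (w : Fin m → ℝ) (i₀ j₀ : Fin m) (hij : j₀ ≠ i₀)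
    (hw : w j₀ ≠ 0) :
    ∃ μ : Fin m → EuclideanSpace ℝ (Fin (m - 2)),
      (∀ c : Fin m → ℝ, ∑ i, c i • μ i = 0 ↔ ∃ a b : ℝ, a • w + b • Pi.single i₀ 1 = c) ∧
      ∀ x : Fin m → ℝ, ∑ i, w i * x i = 0 → x i₀ = 0 →
        ∃ y : EuclideanSpace ℝ (Fin (m - 2)), ∀ i, inner ℝ y (μ i) = x i := by
  let K : Submodule ℝ (Fin m → ℝ) := Submodule.span ℝ {w, Pi.single i₀ 1}
  have hK : Module.finrank ℝ K = 2 := by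
    have hli : LinearIndependent ℝ ![w, Pi.single i₀ 1] := by
      refine LinearIndependent.pair_iff.2 fun s t hst => ?_
      have hs : s = 0 := by simpa [hij, hw] using congrFun hst j₀
      have ht := congrFun hst i₀
      simp only [hs, zero_smul, zero_add, Pi.smul_apply, Pi.single_eq_same, smul_eq_mul, mul_one,
        Pi.zero_apply] at ht
      exact ⟨hs, ht⟩
    have hrange : Set.range ![w, Pi.single i₀ 1] = {w, Pi.single i₀ 1} := by simp [Set.pair_comm]
    have hcard := finrank_span_eq_card hli
    rwa [hrange, Fintype.card_fin] at hcard
  let φ : ((Fin m → ℝ) ⧸ K) ≃ₗ[ℝ] EuclideanSpace ℝ (Fin (m - 2)) :=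
    LinearEquiv.ofFinrankEq _ _ (by simp [Submodule.finrank_quotient, hK])
  let L : (Fin m → ℝ) →ₗ[ℝ] EuclideanSpace ℝ (Fin (m - 2)) := φ.toLinearMap ∘ₗ K.mkQ
  have hL : ∀ c : Fin m → ℝ, ∑ i, c i • L (Pi.single i 1) = L c := by
    intro c
    simp only [← map_smul, ← map_sum]
    congr 1
    ext j
    simp [Finset.sum_apply, Pi.single_apply]
  refine ⟨fun i => L (Pi.single i 1), fun c => ?_, fun x hwx hx => ?_⟩
  · rw [hL, ← Submodule.mem_span_pair]
    simp [L, K]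
  · let g : (Fin m → ℝ) →ₗ[ℝ] ℝ := Fintype.linearCombination ℝ x
    have hg : K ≤ LinearMap.ker g := by
      refine Submodule.span_le.2 ?_
      rintro z (rfl | rfl)
      · simpa [g, Fintype.linearCombination_apply] using hwx
      · simpa [g, Fintype.linearCombination_apply_single] using hx
    let h : EuclideanSpace ℝ (Fin (m - 2)) →ₗ[ℝ] ℝ := K.liftQ g hg ∘ₗ φ.symm.toLinearMap
    refine ⟨(InnerProductSpace.toDual ℝ _).symm h.toContinuousLinearMap, fun i => ?_⟩
    rw [InnerProductSpace.toDual_symm_apply]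
    simp [h, L, g, Fintype.linearCombination_apply_single]

theorem norm_sub_lt_norm_sub_iff {E : Type*} [NormedAddCommGroup E] [InnerProductSpace ℝ E]
    (y a b : E) :
    ‖y - a‖ < ‖y - b‖ ↔ inner ℝ y b - ‖b‖ ^ 2 / 2 < inner ℝ y a - ‖a‖ ^ 2 / 2 := by
  rw [← sq_lt_sq₀ (norm_nonneg _) (norm_nonneg _), norm_sub_sq_real, norm_sub_sq_real]
  constructor <;> intro h <;> linarith

theorem exists_generic_rankingPattern_eq {m : ℕ} (hm : 3 ≤ m) (v : EuclideanSpace ℝ (Fin m))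
    (hsum : ∑ i, v i = 0)
    (hsub : ∀ I : Finset (Fin m), I.Nonempty → I ≠ Finset.univ → ∑ i ∈ I, v i ≠ 0)
    (i₀ : Fin m) (hneg : ∀ i ≠ i₀, v i < 0) :
    ∃ μ : Fin m → EuclideanSpace ℝ (Fin (m - 2)),
      Generic μ ∧ rankingPattern v = rankingPatternUF μ := by
  have : Nonempty (Fin m) := ⟨i₀⟩
  obtain ⟨j₀, hj₀⟩ : ∃ j, j ≠ i₀ := by
    have : Nontrivial (Fin m) := Fin.nontrivial_iff_two_le.2 (by omega)
    exact exists_ne i₀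
  obtain ⟨j₁, hj₁⟩ : ∃ j, j ∉ ({i₀, j₀} : Finset (Fin m)) := by
    by_contra! h
    have := Finset.card_le_card (fun j _ => h j : Finset.univ ⊆ ({i₀, j₀} : Finset (Fin m)))
    have := Finset.card_le_two (a := i₀) (b := j₀)
    simp at *
    omega
  simp only [Finset.mem_insert, Finset.mem_singleton, not_or] at hj₁
  obtain ⟨μ, hrel, hdual⟩ := exists_points_of_relation v i₀ j₀ hj₀ (hneg j₀ hj₀).ne
  have hμ₀ : μ i₀ = 0 := by
    have := (hrel (Pi.single i₀ 1)).2 ⟨0, 1, by simp⟩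
    simpa [Pi.single_apply, ite_smul] using this
  have hvμ : ∑ i, v i • μ i = 0 := (hrel v).2 ⟨1, 0, by simp⟩
  have hμ₁ : μ j₀ ≠ 0 := by
    intro h
    obtain ⟨a, b, hab⟩ := (hrel (Pi.single j₀ 1)).1 (by simp [Pi.single_apply, ite_smul, h])
    have ha : a = 0 := by simpa [hj₁.1, hj₁.2, (hneg j₁ hj₁.1).ne] using congrFun hab j₁
    simpa [ha, hj₀] using congrFun hab j₀
  have hq : ∑ i, v i * ‖μ i‖ ^ 2 < 0 := by
    refine Finset.sum_neg' (fun i _ => ?_) ⟨j₀, Finset.mem_univ _, ?_⟩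
    · obtain rfl | hi := eq_or_ne i i₀
      · simp [hμ₀]
      · exact mul_nonpos_of_nonpos_of_nonneg (hneg i hi).le (by positivity)
    · exact mul_neg_of_neg_of_pos (hneg j₀ hj₀) (by positivity)
  have hcomb : ∀ {N : ℕ} (e : Fin N → Fin m × Fin m) (c : Fin N → ℝ),
      ∑ i, edgeCombination e c i • μ i = 0 → ∃ a : ℝ, edgeCombination e c = a • ⇑v := by
    intro N e c h
    obtain ⟨a, b, hab⟩ := (hrel _).1 h
    have h0 : ∑ i, edgeCombination e c i = 0 := by
      simpa using sum_edgeCombination_mul e c fun _ => 1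
    have hb : b = 0 := by
      simpa [← hab, Finset.sum_add_distrib, ← Finset.mul_sum, hsum] using h0
    exact ⟨a, by simp [← hab, hb]⟩
  refine ⟨μ, ⟨conditionA_of_edgeCombination fun e hne c h => ?_,
    conditionA_of_edgeCombination fun e hne c h => ?_⟩, ?_⟩
  · obtain ⟨a, ha⟩ := hcomb e c h
    obtain ⟨S, hS, hS', hS0⟩ := exists_sum_edgeCombination_eq_zero hne (by simp; omega)
    have h0 := hS0 c
    simp only [ha, Pi.smul_apply, smul_eq_mul, ← Finset.mul_sum] at h0
    rw [ha, (mul_eq_zero.1 h0).resolve_right (hsub S hS hS'), zero_smul]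
  · rw [Prod.ext_iff] at h
    simp only [Prod.fst_sum, Prod.snd_sum, Prod.smul_fst, Prod.smul_snd, Prod.fst_zero,
      Prod.snd_zero, smul_eq_mul] at h
    obtain ⟨a, ha⟩ := hcomb e c h.1
    have h0 := h.2
    simp only [ha, Pi.smul_apply, smul_eq_mul, mul_assoc, ← Finset.mul_sum] at h0
    rw [ha, (mul_eq_zero.1 h0).resolve_right hq.ne, zero_smul]
  · ext σ
    rw [mem_rankingPattern_iff v hsum]
    simp only [rankingPatternUF, Set.mem_ofPred_eq, norm_sub_lt_norm_sub_iff]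
    constructor
    · rintro ⟨x, hx, hpos⟩
      set p := ∑ i, v i * x i
      set q := ∑ i, v i * ‖μ i‖ ^ 2
      let g : Fin m → ℝ := fun i => -q / 2 / p * x i + ‖μ i‖ ^ 2 / 2
      obtain ⟨y, hy⟩ := hdual (fun i => g i - g i₀) (by
        rw [← sum_mul_eq_sum_mul_sub hsum g]
        calc ∑ i, v i * g i = -q / 2 / p * p + q / 2 := by
              simp only [p, q, Finset.mul_sum, Finset.sum_div, ← Finset.sum_add_distrib]
              exact Finset.sum_congr rfl fun i _ => by simp only [g]; ring
          _ = 0 := by field_simp; ring) (sub_self _)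
      refine ⟨y, fun k l hkl => ?_⟩
      have h1 : 0 < -q / 2 / p := div_pos (by linarith) hpos
      have h2 := mul_lt_mul_of_pos_left (hx k l hkl) h1
      simp only [hy, g]
      linarith
    · rintro ⟨y, hy⟩
      refine ⟨fun i => inner ℝ y (μ i) - ‖μ i‖ ^ 2 / 2, hy, ?_⟩
      have h0 : ∑ i, v i * inner ℝ y (μ i) = 0 := by
        simpa [inner_sum, inner_smul_right] using congrArg (inner ℝ y) hvμ
      simp only [mul_sub, Finset.sum_sub_distrib, h0, ← mul_div_assoc, ← Finset.sum_div]
      linarith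

/-- Theorem 4.1, Part 2: if `v ∈ V` has exactly one positive entry, then
`RP(v)` is realized as the ranking pattern of an unfolding model of codimension
one, but `RP(−v)` is not. -/
theorem rankingPattern_realizable_of_exactly_one_pos {m : ℕ} (hm : 3 ≤ m)
    (v : EuclideanSpace ℝ (Fin m)) (hv : v ∈ genericDirections m)
    (hone : ∃! i : Fin m, 0 < v i) :
    (∃ μ : Fin m → EuclideanSpace ℝ (Fin (m - 2)),
        Generic μ ∧ rankingPattern v = rankingPatternUF μ) ∧
      ¬ ∃ μ' : Fin m → EuclideanSpace ℝ (Fin (m - 2)),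
          Generic μ' ∧ rankingPattern (-v) = rankingPatternUF μ' := by
  obtain ⟨hsum, -, hsub⟩ := hv
  obtain ⟨i₀, -, huniq⟩ := hone
  have hneg : ∀ i ≠ i₀, v i < 0 := fun i hi =>
    lt_of_le_of_ne (not_lt.1 fun h => hi (huniq i h)) (by
      have hi' : ({i} : Finset (Fin m)) ≠ Finset.univ := fun h => by
        simpa [hi.symm] using h.ge (Finset.mem_univ i₀)
      simpa using hsub {i} (Finset.singleton_nonempty i) hi')
  refine ⟨exists_generic_rankingPattern_eq hm v hsum hsub i₀ hneg, ?_⟩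
  rintro ⟨μ, -, hμ⟩
  have hsum' : ∑ i, (-v) i = 0 := by simp [hsum]
  have hpos : ∀ i ≠ i₀, 0 < (-v) i := fun i hi => by simpa using hneg i hi
  obtain ⟨σ, hσ, k, hk, hki⟩ := exists_mem_rankingPatternUF_apply_eq μ
    (hμ ▸ rankingPattern_nonempty_of_unique_neg (-v) (by omega) hsum' i₀ hpos) i₀
  exact apply_ne_of_mem_rankingPattern (-v) hsum' i₀ hpos (hμ ▸ hσ) hk hki
end

section
/- Let m ≥ 3 and let c denote the number of connected components of the topological subspace {x ∈ H0 : ∑_{i∈I} x_i ≠ 0 for every nonempty proper subset I ⊂ [m]} of ℝ^m (that is, the number of chambers of the restriction to H0 of the all-subset arrangement). Then the number of distinct ranking patterns of unfolding models of codimension one, q(m) = |{RP^UF(μ_1,…,μ_m) : μ_1,…,μ_m ∈ ℝ^{m−2} generic}|, equals c − m. -/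
open scoped BigOperators

section GraphicMatroid

variable {V : Type*} [DecidableEq V] {ι : Type*}

/-- The signed incidence vector of an edge. -/
def edgeVector (p : V × V) : V → ℝ := Pi.single p.1 1 - Pi.single p.2 1

/-- The simple graph with the given family of edges. -/
def edgeGraph (e : ι → V × V) : SimpleGraph V :=
  SimpleGraph.fromEdgeSet (Set.range fun k => s((e k).1, (e k).2))

lemma sum_edgeVector (s : Finset V) (p : V × V) :
    ∑ i ∈ s, edgeVector p i = (if p.1 ∈ s then 1 else 0) - (if p.2 ∈ s then 1 else 0) := by
  simp [edgeVector, Finset.sum_sub_distrib, Pi.single_apply]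

lemma sum_edgeVector_smul [Fintype V] {E : Type*} [AddCommGroup E] [Module ℝ E]
    (ν : V → E) (p : V × V) :
    ∑ i, edgeVector p i • ν i = ν p.1 - ν p.2 := by
  simp [edgeVector, sub_smul, Finset.sum_sub_distrib, Pi.single_apply, ite_smul]

lemma edgeVector_sub_mem_span_of_reachable {G : SimpleGraph V} {W : Submodule ℝ (V → ℝ)}
    (hW : ∀ u v, G.Adj u v → edgeVector (u, v) ∈ W) {a b : V} (h : G.Reachable a b) :
    edgeVector (a, b) ∈ W := by
  obtain ⟨p⟩ := h
  induction p with
  | nil => simp [edgeVector]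
  | cons h _ ih =>
    have := W.add_mem (hW _ _ h) ih
    simpa [edgeVector] using this

/-- A family of distinct edges is a forest iff its incidence vectors are independent. -/
lemma edgeGraph_isAcyclic_iff [Fintype V] {e : ι → V × V} (hne : ∀ k, (e k).1 ≠ (e k).2)
    (hinj : Function.Injective fun k => s((e k).1, (e k).2)) :
    (edgeGraph e).IsAcyclic ↔ LinearIndependent ℝ fun k => edgeVector (e k) := by
  classical
  have hadj : ∀ k u v, ((edgeGraph e).deleteEdges {s((e k).1, (e k).2)}).Adj u v ↔
      ∃ l, l ≠ k ∧ s((e l).1, (e l).2) = s(u, v) := by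
    intro k u v
    simp only [edgeGraph, SimpleGraph.deleteEdges_adj, SimpleGraph.fromEdgeSet_adj,
      Set.mem_range, Set.mem_singleton_iff]
    constructor
    · rintro ⟨⟨⟨l, hl⟩, -⟩, hk⟩
      exact ⟨l, fun h => hk (by rw [← hl, h]), hl⟩
    · rintro ⟨l, hlk, hl⟩
      refine ⟨⟨⟨l, hl⟩, ?_⟩, fun h => hlk (hinj (hl.trans h))⟩
      rintro rfl
      have : (s((e l).1, (e l).2)).IsDiag := by rw [hl]; exact rfl
      exact hne l (by simpa using this)
  rw [SimpleGraph.isAcyclic_iff_forall_isBridge, linearIndependent_iff_notMem_span]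
  have hedge : (∀ ⦃x⦄, x ∈ (edgeGraph e).edgeSet → (edgeGraph e).IsBridge x) ↔
      ∀ k, ¬ ((edgeGraph e).deleteEdges {s((e k).1, (e k).2)}).Reachable (e k).1 (e k).2 := by
    have hmem : ∀ k, s((e k).1, (e k).2) ∈ (edgeGraph e).edgeSet := fun k => by
      rw [edgeGraph, SimpleGraph.edgeSet_fromEdgeSet]
      exact ⟨⟨k, rfl⟩, by simpa using hne k⟩
    constructor
    · intro h k
      exact SimpleGraph.isBridge_iff.1 (h (hmem k))
    · intro h x hx
      obtain ⟨k, rfl⟩ : ∃ k, s((e k).1, (e k).2) = x := by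
        simp only [edgeGraph, SimpleGraph.edgeSet_fromEdgeSet] at hx
        exact hx.1
      exact SimpleGraph.isBridge_iff.2 (h k)
  rw [hedge]
  refine forall_congr' fun k => not_congr ⟨fun h => ?_, fun h => ?_⟩
  · refine edgeVector_sub_mem_span_of_reachable (fun u v huv => ?_) h
    obtain ⟨l, hlk, hl⟩ := (hadj k u v).1 huv
    have hmem : edgeVector (e l) ∈
        Submodule.span ℝ ((fun k => edgeVector (e k)) '' (Set.univ \ {k})) :=
      Submodule.subset_span ⟨l, by simpa using hlk, rfl⟩
    rcases Sym2.eq_iff.1 hl with ⟨rfl, rfl⟩ | ⟨rfl, rfl⟩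
    · exact hmem
    · have := Submodule.neg_mem _ hmem
      simpa [edgeVector] using this
  · by_contra hr
    set C : Finset V := Finset.univ.filter fun v =>
      ((edgeGraph e).deleteEdges {s((e k).1, (e k).2)}).Reachable (e k).1 v with hC
    let f : (V → ℝ) →ₗ[ℝ] ℝ := ∑ i ∈ C, LinearMap.proj i
    have hf : ∀ w, f w = ∑ i ∈ C, w i := fun w => by simp [f]
    have hker : Submodule.span ℝ ((fun k => edgeVector (e k)) '' (Set.univ \ {k})) ≤
        LinearMap.ker f := by
      rw [Submodule.span_le]
      rintro _ ⟨l, hl, rfl⟩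
      have hl' : l ≠ k := by simpa using hl
      have hA := (hadj k (e l).1 (e l).2).2 ⟨l, hl', rfl⟩
      have : (e l).1 ∈ C ↔ (e l).2 ∈ C := by
        simp only [hC, Finset.mem_filter, Finset.mem_univ, true_and]
        exact ⟨fun h => h.trans hA.reachable, fun h => h.trans hA.symm.reachable⟩
      simp only [SetLike.mem_coe, LinearMap.mem_ker, hf, sum_edgeVector, this, sub_self]
    have := hker h
    rw [LinearMap.mem_ker, hf, sum_edgeVector, if_pos (by simp [hC]),
      if_neg (by simpa [hC])] at this
    norm_num at this

end GraphicMatroid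

section Combinatorics

variable {m : ℕ}

/-- `v` lies in `H0` and off every hyperplane of the all-subset arrangement. -/
def OffAllSubset (v : Fin m → ℝ) : Prop :=
  ∑ i, v i = 0 ∧ ∀ I : Finset (Fin m), I.Nonempty → I ≠ Finset.univ → ∑ i ∈ I, v i ≠ 0

/-- The sets of indices on which `v` has positive sum. -/
def positiveSubsets (v : Fin m → ℝ) : Set (Finset (Fin m)) := {I | 0 < ∑ i ∈ I, v i}

/-- The objects ranked at position at most `k` by `σ`. -/
def initialSegment (σ : Equiv.Perm (Fin m)) (k : Fin m) : Finset (Fin m) :=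
  Finset.univ.filter fun i => σ.symm i ≤ k

/-- The permutations with a proper initial segment outside `P`. -/
def patternOfSubsets (P : Set (Finset (Fin m))) : Set (Equiv.Perm (Fin m)) :=
  {σ | ∃ k, initialSegment σ k ≠ Finset.univ ∧ initialSegment σ k ∉ P}

lemma initialSegment_nonempty (σ : Equiv.Perm (Fin m)) (k : Fin m) :
    (initialSegment σ k).Nonempty :=
  ⟨σ k, by simp [initialSegment]⟩

lemma sum_initialSegment (σ : Equiv.Perm (Fin m)) (k : Fin m) (v : Fin m → ℝ) :
    ∑ i ∈ initialSegment σ k, v i = ∑ j, if j ≤ k then v (σ j) else 0 := by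
  rw [initialSegment, Finset.sum_filter, ← Equiv.sum_comp σ]
  simp

lemma OffAllSubset.pos_of_nonneg {v : Fin m → ℝ} (hv : OffAllSubset v) {I : Finset (Fin m)}
    (h1 : I.Nonempty) (h2 : I ≠ Finset.univ) (h : 0 ≤ ∑ i ∈ I, v i) : 0 < ∑ i ∈ I, v i :=
  lt_of_le_of_ne h (hv.2 I h1 h2).symm

lemma nonempty_of_mem_positiveSubsets {v : Fin m → ℝ} {I : Finset (Fin m)}
    (h : I ∈ positiveSubsets v) : I.Nonempty := by
  by_contra hI
  simp [positiveSubsets, Finset.not_nonempty_iff_eq_empty.1 hI] at h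

lemma OffAllSubset.ne_univ {v : Fin m → ℝ} (hv : OffAllSubset v) {I : Finset (Fin m)}
    (h : I ∈ positiveSubsets v) : I ≠ Finset.univ := by
  rintro rfl
  simp [positiveSubsets, hv.1] at h

/-- Every set of positive sum is an initial segment of a permutation all of whose proper initial
segments have positive sum. -/
lemma OffAllSubset.exists_perm {v : Fin m → ℝ} (hv : OffAllSubset v) {I : Finset (Fin m)}
    (hI : I ∈ positiveSubsets v) :
    ∃ σ, σ ∉ patternOfSubsets (positiveSubsets v) ∧ ∃ k, initialSegment σ k = I := by
  classical
  have hpos : 0 < ∑ i ∈ I, v i := hI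
  let f : Fin m → ℕ := fun i => (if i ∈ I then 0 else 2) + if 0 < v i then 0 else 1
  let σ := Tuple.sort f
  have hlow : ∀ k i j, i ∈ initialSegment σ k → f j < f i → j ∈ initialSegment σ k := by
    intro k i j hi hj
    simp only [initialSegment, Finset.mem_filter, Finset.mem_univ, true_and] at hi ⊢
    refine le_trans (le_of_lt ?_) hi
    by_contra! h
    have := Tuple.monotone_sort f h
    simp only [Function.comp] at this
    change f (σ (σ.symm i)) ≤ f (σ (σ.symm j)) at this
    simp only [Equiv.apply_symm_apply] at this
    omega
  refine ⟨σ, ?_, ?_⟩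
  · rintro ⟨k, hk, hkP⟩
    apply hkP
    refine hv.pos_of_nonneg (initialSegment_nonempty _ _) hk ?_
    set S := initialSegment σ k
    have hlow := hlow k
    by_cases hSI : S ⊆ I
    · by_cases hneg : ∃ i ∈ S, ¬ 0 < v i
      · obtain ⟨i, hi, hvi⟩ := hneg
        have hrest : ∑ j ∈ I \ S, v j ≤ 0 := by
          refine Finset.sum_nonpos fun j hj => ?_
          rw [Finset.mem_sdiff] at hj
          by_contra! h
          exact hj.2 (hlow i j hi (by simp [f, hj.1, h, hvi, hSI hi]))
        have := Finset.sum_sdiff hSI (f := v)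
        linarith
      · push Not at hneg
        exact Finset.sum_nonneg fun i hi => (hneg i hi).le
    · obtain ⟨i₀, hi₀, hi₀I⟩ := Finset.not_subset.1 hSI
      have hIS : I ⊆ S := fun j hj => hlow i₀ j hi₀ (by
        simp only [f, hj, hi₀I]; split_ifs <;> simp_all)
      by_cases hneg : ∃ i ∈ S, i ∉ I ∧ ¬ 0 < v i
      · obtain ⟨i, hi, hiI, hvi⟩ := hneg
        have hrest : ∑ j ∈ Finset.univ \ S, v j ≤ 0 := by
          refine Finset.sum_nonpos fun j hj => ?_
          rw [Finset.mem_sdiff] at hj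
          by_contra! h
          exact hj.2 (hlow i j hi (by
            have : j ∉ I := fun h => hj.2 (hIS h)
            simp [f, this, h, hvi, hiI]))
        have := Finset.sum_sdiff (Finset.subset_univ S) (f := v)
        have := hv.1
        linarith
      · push Not at hneg
        have hrest : 0 ≤ ∑ j ∈ S \ I, v j := by
          refine Finset.sum_nonneg fun j hj => ?_
          rw [Finset.mem_sdiff] at hj
          exact (hneg j hj.1 hj.2).le
        have := Finset.sum_sdiff hIS (f := v)
        linarith
  · obtain ⟨i, hi, hmax⟩ :=
      Finset.exists_max_image I σ.symm (nonempty_of_mem_positiveSubsets hI)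
    refine ⟨σ.symm i, ?_⟩
    ext j
    constructor
    · intro hj
      by_contra hjI
      have := hlow (σ.symm j) j i (by simp [initialSegment]) (by
        simp only [f, if_pos hi, if_neg hjI]; split_ifs <;> omega)
      simp only [initialSegment, Finset.mem_filter, Finset.mem_univ, true_and] at this hj
      exact hjI (σ.symm.injective (le_antisymm hj this) ▸ hi)
    · intro hj
      simpa [initialSegment] using hmax j hj

lemma OffAllSubset.mem_positiveSubsets_iff {v : Fin m → ℝ} (hv : OffAllSubset v)
    {I : Finset (Fin m)} : I ∈ positiveSubsets v ↔ I ≠ Finset.univ ∧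
      ∃ σ, σ ∉ patternOfSubsets (positiveSubsets v) ∧ ∃ k, initialSegment σ k = I := by
  refine ⟨fun h => ⟨hv.ne_univ h, hv.exists_perm h⟩, ?_⟩
  rintro ⟨h, σ, hσ, k, rfl⟩
  by_contra hk
  exact hσ ⟨k, h, hk⟩

lemma injOn_patternOfSubsets :
    Set.InjOn patternOfSubsets (positiveSubsets '' {v : Fin m → ℝ | OffAllSubset v}) := by
  rintro _ ⟨v, hv, rfl⟩ _ ⟨w, hw, rfl⟩ h
  ext I
  rw [OffAllSubset.mem_positiveSubsets_iff hv, OffAllSubset.mem_positiveSubsets_iff hw, h]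

/-- The proper subsets containing `i`. -/
def properSubsetsContaining (i : Fin m) : Set (Finset (Fin m)) := {I | i ∈ I ∧ I ≠ Finset.univ}

lemma OffAllSubset.apply_ne_zero {v : Fin m → ℝ} (hm : 2 ≤ m) (hv : OffAllSubset v)
    (i : Fin m) : v i ≠ 0 := by
  have := hv.2 {i} (by simp) (by
    intro h
    have := congrArg Finset.card h
    simp at this
    omega)
  simpa using this

lemma OffAllSubset.positiveSubsets_eq {v : Fin m → ℝ} (hv : OffAllSubset v)
    {i : Fin m} (hi : ∀ j, j ≠ i → v j ≤ 0) :
    positiveSubsets v = properSubsetsContaining i := by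
  ext I
  constructor
  · intro hI
    refine ⟨?_, hv.ne_univ hI⟩
    by_contra hiI
    have : ∑ j ∈ I, v j ≤ 0 :=
      Finset.sum_nonpos fun j hj => hi j (by rintro rfl; exact hiI hj)
    exact absurd hI (not_lt.2 this)
  · rintro ⟨hiI, hI⟩
    refine hv.pos_of_nonneg ⟨i, hiI⟩ hI ?_
    have : ∑ j ∈ Finset.univ \ I, v j ≤ 0 := by
      refine Finset.sum_nonpos fun j hj => hi j ?_
      rintro rfl
      simp [hiI] at hj
    have h1 := Finset.sum_sdiff (Finset.subset_univ I) (f := v)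
    have := hv.1
    linarith

lemma apply_nonpos_of_positiveSubsets_eq {v : Fin m → ℝ} {i : Fin m}
    (h : positiveSubsets v = properSubsetsContaining i) (j : Fin m) (hj : j ≠ i) : v j ≤ 0 := by
  have : {j} ∉ positiveSubsets v := by
    rw [h]
    rintro ⟨h, -⟩
    exact hj (Finset.mem_singleton.1 h).symm
  simpa [positiveSubsets] using this

lemma exists_positiveSubsets_eq (i : Fin m) :
    ∃ v : Fin m → ℝ, OffAllSubset v ∧ positiveSubsets v = properSubsetsContaining i := by
  classical
  let v : Fin m → ℝ := fun j => (if j = i then (m : ℝ) else 0) - 1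
  have hsum : ∀ I : Finset (Fin m), ∑ j ∈ I, v j = (if i ∈ I then (m : ℝ) else 0) - I.card := by
    intro I
    simp [v, Finset.sum_sub_distrib]
  have hv : OffAllSubset v := by
    refine ⟨by simp [hsum], fun I hI hI' => ?_⟩
    rw [hsum]
    have h1 : (0 : ℝ) < I.card := by exact_mod_cast hI.card_pos
    have h2 : (I.card : ℝ) < m := by
      simpa using Finset.card_lt_card (Finset.ssubset_univ_iff.2 hI')
    split_ifs <;> intro h <;> linarith
  exact ⟨v, hv, hv.positiveSubsets_eq fun j hj => by simp [v, hj]⟩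

lemma properSubsetsContaining_injective (hm : 2 ≤ m) :
    Function.Injective (properSubsetsContaining : Fin m → Set (Finset (Fin m))) := by
  intro i j h
  have : ({i} : Finset (Fin m)) ∈ properSubsetsContaining j := by
    rw [← h]
    refine ⟨by simp, fun h => ?_⟩
    have := congrArg Finset.card h
    simp at this
    omega
  exact (Finset.mem_singleton.1 this.1).symm

lemma sum_mul_le_of_partial_sums_nonneg (n : ℕ) (a b : Fin (n + 1) → ℝ) (hb : Monotone b)
    (ha : ∀ k, k ≠ Fin.last n → 0 ≤ ∑ j, if j ≤ k then a j else 0) :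
    ∑ j, a j * b j ≤ (∑ j, a j) * b (Fin.last n) := by
  induction n with
  | zero => simp
  | succ n ih =>
    rw [Fin.sum_univ_castSucc, Fin.sum_univ_castSucc (f := a)]
    have h1 : ∀ k : Fin (n + 1), 0 ≤ ∑ j, if j ≤ k then a j.castSucc else 0 := by
      intro k
      have := ha k.castSucc (Fin.castSucc_lt_last k).ne
      rw [Fin.sum_univ_castSucc] at this
      simpa [(Fin.castSucc_lt_last k).not_ge] using this
    have h2 := ih (fun j => a j.castSucc) (fun j => b j.castSucc)
      (fun i j h => hb (by simpa using h)) fun k _ => h1 k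
    have h3 : 0 ≤ ∑ j : Fin (n + 1), a j.castSucc := by
      simpa [Fin.le_last] using h1 (Fin.last n)
    have h4 : b (Fin.last n).castSucc ≤ b (Fin.last (n + 1)) := hb (Fin.le_last _)
    nlinarith [mul_le_mul_of_nonneg_left h4 h3]

/-- Abel summation: a ranking chamber meets the open half-space `∑ vᵢ xᵢ > 0` iff some initial
segment has negative `v`-sum. -/
lemma OffAllSubset.mem_patternOfSubsets_iff {v : Fin m → ℝ} (hm : 0 < m) (hv : OffAllSubset v)
    (σ : Equiv.Perm (Fin m)) : σ ∈ patternOfSubsets (positiveSubsets v) ↔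
      ∃ x : Fin m → ℝ, StrictMono (x ∘ σ) ∧ 0 < ∑ i, v i * x i := by
  constructor
  · rintro ⟨k, hk, hkP⟩
    have hneg : ∑ i ∈ initialSegment σ k, v i < 0 :=
      lt_of_le_of_ne (not_lt.1 hkP) (hv.2 _ (initialSegment_nonempty _ _) hk)
    set s := ∑ i ∈ initialSegment σ k, v i with hs
    set A := ∑ i, v i * ((σ.symm i : ℕ) : ℝ) with hA
    let R : ℝ := (|A| + 1) / (-s)
    have hR : 0 ≤ R := by have : 0 < -s := by linarith
                          positivity
    refine ⟨fun i => ((σ.symm i : ℕ) : ℝ) - if i ∈ initialSegment σ k then R else 0, ?_, ?_⟩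
    · intro i j hij
      have : ((i : ℕ) : ℝ) < ((j : ℕ) : ℝ) := by exact_mod_cast hij
      simp only [Function.comp, Equiv.symm_apply_apply, initialSegment, Finset.mem_filter,
        Finset.mem_univ, true_and]
      split_ifs with h1 h2 h2
      · linarith
      · linarith
      · exact absurd (hij.le.trans h2) h1
      · linarith
    · have h1 : ∑ i, v i * (((σ.symm i : ℕ) : ℝ) - if i ∈ initialSegment σ k then R else 0) =
          A - s * R := by
        simp only [mul_sub, Finset.sum_sub_distrib, hA, hs, mul_ite, mul_zero, Finset.sum_mul]
        simp
      have h2 : s * R = -(|A| + 1) := by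
        simp only [R]; rw [div_neg, mul_neg, mul_div_cancel₀ _ hneg.ne]
      rw [h1, h2]
      linarith [neg_abs_le A]
  · rintro ⟨x, hx, hpos⟩
    by_contra hσ
    obtain ⟨n, rfl⟩ : ∃ n, m = n + 1 := ⟨m - 1, by omega⟩
    have := sum_mul_le_of_partial_sums_nonneg n (fun j => v (σ j)) (x ∘ σ) hx.monotone (by
      intro k hk
      rw [← sum_initialSegment]
      by_contra h
      refine hσ ⟨k, fun h' => hk ?_, fun h' => h (le_of_lt h')⟩
      have : σ (Fin.last n) ∈ initialSegment σ k := by rw [h']; simp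
      simp [initialSegment] at this
      exact this)
    rw [Equiv.sum_comp σ v, hv.1] at this
    simp only [Function.comp] at this
    rw [Equiv.sum_comp σ fun i => v i * x i] at this
    linarith

end Combinatorics

section Chambers

variable {m : ℕ}

lemma convex_chamber (P : Set (Finset (Fin m))) :
    Convex ℝ {x : EuclideanSpace ℝ (Fin m) | OffAllSubset x ∧ positiveSubsets x = P} := by
  intro x hx y hy a b ha hb hab
  have hsum : ∀ I : Finset (Fin m), ∑ i ∈ I, (a • x + b • y) i =
      a * ∑ i ∈ I, x i + b * ∑ i ∈ I, y i := by
    intro I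
    simp [Finset.sum_add_distrib, Finset.mul_sum]
  have hpos : ∀ I ∈ P, 0 < ∑ i ∈ I, (a • x + b • y) i := by
    intro I hI
    have h1 : 0 < ∑ i ∈ I, x i := by rw [← hx.2] at hI; exact hI
    have h2 : 0 < ∑ i ∈ I, y i := by rw [← hy.2] at hI; exact hI
    rw [hsum]
    rcases ha.eq_or_lt with rfl | ha
    · have : b = 1 := by linarith
      simpa [this] using h2
    · have := mul_pos ha h1
      have := mul_nonneg hb h2.le
      linarith
  have hneg : ∀ I : Finset (Fin m), I.Nonempty → I ≠ Finset.univ → I ∉ P →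
      ∑ i ∈ I, (a • x + b • y) i < 0 := by
    intro I hne huniv hI
    have h1 : ∑ i ∈ I, x i < 0 :=
      lt_of_le_of_ne (not_lt.1 fun h => hI (hx.2 ▸ h)) (hx.1.2 I hne huniv)
    have h2 : ∑ i ∈ I, y i < 0 :=
      lt_of_le_of_ne (not_lt.1 fun h => hI (hy.2 ▸ h)) (hy.1.2 I hne huniv)
    rw [hsum]
    rcases ha.eq_or_lt with rfl | ha
    · have : b = 1 := by linarith
      simpa [this] using h2
    · have := mul_neg_of_pos_of_neg ha h1
      have := mul_nonpos_of_nonneg_of_nonpos hb h2.le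
      linarith
  have hzero : ∑ i, (a • x + b • y) i = 0 := by rw [hsum, hx.1.1, hy.1.1]; simp
  refine ⟨⟨hzero, fun I hne huniv => ?_⟩, ?_⟩
  · by_cases hI : I ∈ P
    · exact (hpos I hI).ne'
    · exact (hneg I hne huniv hI).ne
  · ext I
    refine ⟨fun h => ?_, hpos I⟩
    by_contra hI
    have h' : 0 < ∑ i ∈ I, (a • x + b • y) i := h
    rcases I.eq_empty_or_nonempty with rfl | hne
    · simp at h'
    · by_cases huniv : I = Finset.univ
      · rw [huniv, hzero] at h'
        exact h'.false
      · exact h'.not_ge (hneg I hne huniv hI).le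

lemma connectedComponent_eq_iff_positiveSubsets_eq
    (x y : {x : EuclideanSpace ℝ (Fin m) // OffAllSubset x}) :
    connectedComponent x = connectedComponent y ↔
      positiveSubsets (x : EuclideanSpace ℝ (Fin m)) =
        positiveSubsets (y : EuclideanSpace ℝ (Fin m)) := by
  have hcont : ∀ I : Finset (Fin m), Continuous
      fun z : {x : EuclideanSpace ℝ (Fin m) // OffAllSubset x} => ∑ i ∈ I, z.1 i := by
    intro I
    fun_prop
  constructor
  · intro h
    have hclopen : ∀ I : Finset (Fin m), IsClopen
        {z : {x : EuclideanSpace ℝ (Fin m) // OffAllSubset x} | 0 < ∑ i ∈ I, z.1 i} := by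
      intro I
      refine ⟨?_, isOpen_lt continuous_const (hcont I)⟩
      by_cases hne : I.Nonempty
      · by_cases huniv : I = Finset.univ
        · have : {z : {x : EuclideanSpace ℝ (Fin m) // OffAllSubset x} |
              0 < ∑ i ∈ I, z.1 i} = ∅ := by
            ext z
            simp [huniv, z.2.1]
          rw [this]
          exact isClosed_empty
        · have : {z : {x : EuclideanSpace ℝ (Fin m) // OffAllSubset x} |
              0 < ∑ i ∈ I, z.1 i} = {z | 0 ≤ ∑ i ∈ I, z.1 i} := by
            ext z
            exact ⟨fun h => le_of_lt (Set.mem_ofPred.1 h), fun h =>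
              lt_of_le_of_ne h (z.2.2 I hne huniv).symm⟩
          rw [this]
          exact isClosed_le continuous_const (hcont I)
      · simp [Finset.not_nonempty_iff_eq_empty.1 hne]
    ext I
    constructor
    · intro hI
      exact (hclopen I).connectedComponent_subset hI (h ▸ mem_connectedComponent)
    · intro hI
      exact (hclopen I).connectedComponent_subset hI (h ▸ mem_connectedComponent)
  · intro h
    have hpre : IsPreconnected {z : {x : EuclideanSpace ℝ (Fin m) // OffAllSubset x} |
        positiveSubsets z.1 = positiveSubsets x.1} := by
      refine (Topology.IsInducing.subtypeVal
      (t := {x : EuclideanSpace ℝ (Fin m) | OffAllSubset x})).isPreconnected_image.1 ?_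
      convert (convex_chamber (positiveSubsets x.1)).isPreconnected using 1
      ext z
      constructor
      · rintro ⟨w, hw, rfl⟩
        exact ⟨w.2, hw⟩
      · rintro ⟨h1, h2⟩
        exact ⟨⟨z, h1⟩, h2, rfl⟩
    exact connectedComponent_eq (hpre.subset_connectedComponent (x := x) rfl h.symm)

lemma card_connectedComponents_offAllSubset :
    Nat.card (ConnectedComponents {x : EuclideanSpace ℝ (Fin m) // OffAllSubset x}) =
      (positiveSubsets '' {v : Fin m → ℝ | OffAllSubset v}).ncard := by
  let f : ConnectedComponents {x : EuclideanSpace ℝ (Fin m) // OffAllSubset x} →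
      Set (Finset (Fin m)) := Quotient.lift (fun x => positiveSubsets x.1)
    fun x y h => (connectedComponent_eq_iff_positiveSubsets_eq x y).1 h
  have hf : Function.Injective f := by
    rintro ⟨x⟩ ⟨y⟩ h
    exact Quotient.sound ((connectedComponent_eq_iff_positiveSubsets_eq x y).2 h)
  rw [← Nat.card_range_of_injective hf, Nat.card_coe_set_eq]
  congr 1
  ext P
  constructor
  · rintro ⟨⟨x⟩, rfl⟩
    exact ⟨x.1, x.2, rfl⟩
  · rintro ⟨v, hv, rfl⟩
    exact ⟨ConnectedComponents.mk ⟨WithLp.toLp 2 v, hv⟩, rfl⟩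

end Chambers

section Genericity

variable {m : ℕ} {E : Type*} [AddCommGroup E] [Module ℝ E]

lemma conditionA_of_disjoint {N : ℕ} {ν : Fin m → E}
    (h : ∀ e : Fin N → Fin m × Fin m,
      ∀ w ∈ Submodule.span ℝ (Set.range fun k => edgeVector (e k)),
        ∑ i, w i • ν i = 0 → w = 0) : ConditionA N ν := by
  intro e hne hinj
  have h1 : (fun k => ν (e k).1 - ν (e k).2) =
      Fintype.linearCombination ℝ ν ∘ fun k => edgeVector (e k) := by
    ext k
    simp only [Function.comp, Fintype.linearCombination_apply, sum_edgeVector_smul]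
  rw [h1, LinearMap.linearIndependent_iff_of_disjoint]
  · exact edgeGraph_isAcyclic_iff hne hinj
  · rw [Submodule.disjoint_def]
    intro w hw hw'
    exact h e w hw (by simpa [Fintype.linearCombination_apply] using hw')

lemma ConditionA.eq_zero_of_star_relation {N : ℕ} {ν : Fin m → E} (hA : ConditionA N ν)
    {c : Fin m → Fin m} (hc : ∀ i, c (c i) = c i)
    (hN : (Finset.univ.filter fun i => c i ≠ i).card = N) {w : Fin m → ℝ}
    (hw : ∑ i, w i • (ν i - ν (c i)) = 0) {i : Fin m} (hi : c i ≠ i) : w i = 0 := by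
  classical
  set D := Finset.univ.filter fun i => c i ≠ i with hD
  let en : Fin N ≃ D := (D.equivFinOfCardEq hN).symm
  have hen : ∀ k, c (en k) ≠ (en k : Fin m) := fun k =>
    (Finset.mem_filter.1 (en k).2).2
  let e : Fin N → Fin m × Fin m := fun k => (en k, c (en k))
  have hne : ∀ k, (e k).1 ≠ (e k).2 := fun k => (hen k).symm
  have hcenter : ∀ k l, c (en k) ≠ (en l : Fin m) := fun k l h => hen l (by rw [← h, hc])
  have hinj : Function.Injective fun k => s((e k).1, (e k).2) := by
    intro k l h
    rcases Sym2.eq_iff.1 h with ⟨h1, -⟩ | ⟨h1, -⟩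
    · exact en.injective (Subtype.ext h1)
    · exact absurd h1.symm (hcenter l k)
  have hli : LinearIndependent ℝ fun k => edgeVector (e k) := by
    rw [Fintype.linearIndependent_iff]
    intro g hg k
    have h := congrFun hg (en k)
    have hent : ∀ l, edgeVector (e l) (en k) = if l = k then 1 else 0 := by
      intro l
      have h1 : (en k : Fin m) ≠ c (en l) := (hcenter l k).symm
      have h2 : (en k : Fin m) = en l ↔ l = k :=
        ⟨fun h => (en.injective (Subtype.ext h)).symm, fun h => by rw [h]⟩
      simp [edgeVector, e, Pi.single_apply, h1, h2]
    simpa [Finset.sum_apply, hent] using h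
  have hli' := (hA e hne hinj).1 ((edgeGraph_isAcyclic_iff hne hinj).2 hli)
  rw [Fintype.linearIndependent_iff] at hli'
  have hiD : i ∈ D := by simp [hD, hi]
  have hsum : ∑ k, w (en k) • (ν (e k).1 - ν (e k).2) = 0 := by
    rw [← hw]
    have h1 : ∑ k, w (en k) • (ν (e k).1 - ν (e k).2) =
        ∑ i : D, w i • (ν i - ν (c i)) :=
      Equiv.sum_comp en fun i : D => w i • (ν i - ν (c i))
    rw [h1, Finset.sum_coe_sort D fun i => w i • (ν i - ν (c i))]
    refine Finset.sum_subset (Finset.subset_univ _) fun j _ hj => ?_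
    have : c j = j := by simpa [hD] using hj
    rw [this, sub_self, smul_zero]
  have := hli' (fun k => w (en k)) hsum (en.symm ⟨i, hiD⟩)
  simpa using this

lemma edgeVector_sum_eq_zero_of_mem_span {ι : Type*} {e : ι → Fin m × Fin m} {s : Finset (Fin m)}
    (hs : ∀ k, (e k).1 ∈ s ↔ (e k).2 ∈ s) {w : Fin m → ℝ}
    (hw : w ∈ Submodule.span ℝ (Set.range fun k => edgeVector (e k))) : ∑ i ∈ s, w i = 0 := by
  let f : (Fin m → ℝ) →ₗ[ℝ] ℝ := ∑ i ∈ s, LinearMap.proj i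
  have hf : ∀ w, f w = ∑ i ∈ s, w i := fun w => by simp [f]
  have hker : Submodule.span ℝ (Set.range fun k => edgeVector (e k)) ≤ LinearMap.ker f := by
    rw [Submodule.span_le]
    rintro _ ⟨k, rfl⟩
    simp only [SetLike.mem_coe, LinearMap.mem_ker, hf, sum_edgeVector, hs k, sub_self]
  rw [← hf]
  exact hker hw

/-- Fewer than `m - 1` edges leave some nonempty proper set of vertices closed under adjacency. -/
lemma exists_separating_finset (hm : 2 ≤ m) (e : Fin (m - 2) → Fin m × Fin m) :
    ∃ I : Finset (Fin m), I.Nonempty ∧ I ≠ Finset.univ ∧ ∀ k, (e k).1 ∈ I ↔ (e k).2 ∈ I := by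
  classical
  have hnc : ¬ (edgeGraph e).Connected := by
    intro h
    have h1 := h.card_vert_le_card_edgeSet_add_one
    have h2 : Nat.card (edgeGraph e).edgeSet ≤ m - 2 := by
      have : (edgeGraph e).edgeSet ⊆ Set.range fun k => s((e k).1, (e k).2) := by
        rw [edgeGraph, SimpleGraph.edgeSet_fromEdgeSet]
        exact Set.sdiff_subset
      calc Nat.card (edgeGraph e).edgeSet
          ≤ Nat.card (Set.range fun k => s((e k).1, (e k).2)) :=
            Nat.card_mono (Set.finite_range _) this
        _ ≤ Nat.card (Fin (m - 2)) := Finite.card_range_le _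
        _ = m - 2 := by simp
    simp only [Nat.card_eq_fintype_card, Fintype.card_fin] at h1 h2
    omega
  have : Nonempty (Fin m) := ⟨⟨0, by omega⟩⟩
  rw [SimpleGraph.connected_iff] at hnc
  have : ¬ (edgeGraph e).Preconnected := fun h => hnc ⟨h, this⟩
  simp only [SimpleGraph.Preconnected, not_forall] at this
  obtain ⟨a, b, hab⟩ := this
  refine ⟨Finset.univ.filter fun i => (edgeGraph e).Reachable a i, ⟨a, by simp⟩, fun h => ?_,
    fun k => ?_⟩
  · have : b ∈ Finset.univ.filter fun i => (edgeGraph e).Reachable a i := by rw [h]; simp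
    exact hab (by simpa using this)
  · by_cases hk : (e k).1 = (e k).2
    · rw [hk]
    · have hadj : (edgeGraph e).Adj (e k).1 (e k).2 := by
        rw [edgeGraph, SimpleGraph.fromEdgeSet_adj]
        exact ⟨⟨k, rfl⟩, hk⟩
      simp only [Finset.mem_filter, Finset.mem_univ, true_and]
      exact ⟨fun h => h.trans hadj.reachable, fun h => h.trans hadj.symm.reachable⟩

end Genericity

section Dependency

variable {m : ℕ}

/-- `v` spans the affine dependencies of `μ`, and `∑ vᵢ ‖μᵢ‖² > 0`. -/
structure IsDependency {E : Type*} [NormedAddCommGroup E] [InnerProductSpace ℝ E]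
    (μ : Fin m → E) (v : Fin m → ℝ) : Prop where
  sum_smul : ∑ i, v i • μ i = 0
  unique : ∀ w : Fin m → ℝ, ∑ i, w i = 0 → ∑ i, w i • μ i = 0 → ∃ t : ℝ, w = t • v
  pos : 0 < ∑ i, v i * ‖μ i‖ ^ 2

lemma IsDependency.generic (hm : 2 ≤ m) {μ : Fin m → EuclideanSpace ℝ (Fin (m - 2))}
    {v : Fin m → ℝ} (hv : OffAllSubset v) (h : IsDependency μ v) : Generic μ := by
  refine ⟨conditionA_of_disjoint fun e w hw hw0 => ?_, conditionA_of_disjoint fun e w hw hw0 => ?_⟩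
  · obtain ⟨I, hne, huniv, hI⟩ := exists_separating_finset hm e
    obtain ⟨t, rfl⟩ :=
      h.unique w (edgeVector_sum_eq_zero_of_mem_span (by simp) hw) hw0
    have := edgeVector_sum_eq_zero_of_mem_span hI hw
    simp only [Pi.smul_apply, smul_eq_mul, ← Finset.mul_sum] at this
    rw [(mul_eq_zero.1 this).resolve_right (hv.2 I hne huniv), zero_smul]
  · have h1 : ∑ i, w i • μ i = 0 := by
      have := congrArg Prod.fst hw0
      simpa [Prod.fst_sum] using this
    have h2 : ∑ i, w i * ‖μ i‖ ^ 2 = 0 := by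
      have := congrArg Prod.snd hw0
      simpa [Prod.snd_sum] using this
    obtain ⟨t, rfl⟩ :=
      h.unique w (edgeVector_sum_eq_zero_of_mem_span (by simp) hw) h1
    simp only [Pi.smul_apply, smul_eq_mul, mul_assoc, ← Finset.mul_sum] at h2
    rw [(mul_eq_zero.1 h2).resolve_right h.pos.ne', zero_smul]

lemma exists_affine_dependency (hm : 2 ≤ m) (μ : Fin m → EuclideanSpace ℝ (Fin (m - 2))) :
    ∃ v : Fin m → ℝ, v ≠ 0 ∧ ∑ i, v i = 0 ∧ ∑ i, v i • μ i = 0 := by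
  have hker : LinearMap.ker (Fintype.linearCombination ℝ
      fun i => (μ i, (1 : ℝ))) ≠ ⊥ := by
    apply LinearMap.ker_ne_bot_of_finrank_lt
    simp
    omega
  obtain ⟨v, hv, hv0⟩ := Submodule.exists_mem_ne_zero_of_ne_bot hker
  rw [LinearMap.mem_ker, Fintype.linearCombination_apply] at hv
  refine ⟨v, hv0, ?_, ?_⟩
  · have := congrArg Prod.snd hv
    simpa [Prod.snd_sum] using this
  · have := congrArg Prod.fst hv
    simpa [Prod.fst_sum] using this

lemma ConditionA.offAllSubset {μ : Fin m → EuclideanSpace ℝ (Fin (m - 2))}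
    (hA : ConditionA (m - 2) μ) {v : Fin m → ℝ} (hv0 : v ≠ 0) (hv1 : ∑ i, v i = 0)
    (hv2 : ∑ i, v i • μ i = 0) : OffAllSubset v := by
  classical
  refine ⟨hv1, fun I hne huniv hI => hv0 ?_⟩
  obtain ⟨a, ha⟩ := hne
  obtain ⟨b, hb⟩ : ∃ b, b ∉ I := by
    by_contra! h
    exact huniv (Finset.eq_univ_iff_forall.2 h)
  have hab : a ≠ b := by rintro rfl; exact hb ha
  let c : Fin m → Fin m := fun i => if i ∈ I then a else b
  have hc : ∀ i, c (c i) = c i := by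
    intro i
    by_cases hi : i ∈ I <;> simp [c, hi, ha, hb]
  have hfix : ∀ i, c i ≠ i ↔ i ∉ ({a, b} : Finset (Fin m)) := by
    intro i
    simp only [Finset.mem_insert, Finset.mem_singleton, not_or, c]
    split_ifs with hi
    · exact ⟨fun h => ⟨h.symm, by rintro rfl; exact hb hi⟩, fun h => Ne.symm h.1⟩
    · exact ⟨fun h => ⟨by rintro rfl; exact hi ha, h.symm⟩, fun h => Ne.symm h.2⟩
  have hcompl : ∑ i ∈ Finset.univ \ I, v i = 0 := by
    have := Finset.sum_sdiff (Finset.subset_univ I) (f := v)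
    linarith
  have hcard : (Finset.univ.filter fun i => c i ≠ i).card = m - 2 := by
    simp only [hfix]
    rw [Finset.filter_notMem_eq_sdiff, Finset.card_sdiff_of_subset (Finset.subset_univ _),
      Finset.card_pair hab]
    simp
  have hsum : ∑ i, v i • (μ i - μ (c i)) = 0 := by
    simp only [smul_sub, Finset.sum_sub_distrib, hv2, zero_sub, neg_eq_zero]
    rw [← Finset.sum_sdiff (Finset.subset_univ I)]
    have h1 : ∑ i ∈ Finset.univ \ I, v i • μ (c i) = ∑ i ∈ Finset.univ \ I, v i • μ b :=
      Finset.sum_congr rfl fun i hi => by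
        have : i ∉ I := (Finset.mem_sdiff.1 hi).2
        simp [c, this]
    have h2 : ∑ i ∈ I, v i • μ (c i) = ∑ i ∈ I, v i • μ a :=
      Finset.sum_congr rfl fun i hi => by simp [c, hi]
    rw [h1, h2, ← Finset.sum_smul, ← Finset.sum_smul, hI, hcompl, zero_smul, zero_smul, add_zero]
  have hzero : ∀ i, i ≠ a → i ≠ b → v i = 0 := fun i h1 h2 =>
    hA.eq_zero_of_star_relation hc hcard hsum ((hfix i).2 (by simp [h1, h2]))
  have hva : v a = 0 := by
    rw [← hI, Finset.sum_eq_single_of_mem a ha]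
    intro i hi hia
    exact hzero i hia (by rintro rfl; exact hb hi)
  have hvb : v b = 0 := by
    rw [← hcompl, Finset.sum_eq_single_of_mem b (by simp [hb])]
    intro i hi hib
    exact hzero i (by rintro rfl; simp [ha] at hi) hib
  ext i
  by_cases h1 : i = a
  · simp [h1, hva]
  · by_cases h2 : i = b
    · simp [h2, hvb]
    · exact hzero i h1 h2

lemma Generic.exists_isDependency (hm : 2 ≤ m) {μ : Fin m → EuclideanSpace ℝ (Fin (m - 2))}
    (hμ : Generic μ) : ∃ v, OffAllSubset v ∧ IsDependency μ v := by
  classical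
  obtain ⟨v, hv0, hv1, hv2⟩ := exists_affine_dependency hm μ
  have hv := hμ.1.offAllSubset hv0 hv1 hv2
  have hunique : ∀ w : Fin m → ℝ, ∑ i, w i = 0 → ∑ i, w i • μ i = 0 → ∃ t : ℝ, w = t • v := by
    intro w hw1 hw2
    let a : Fin m := ⟨0, by omega⟩
    have ha : v a ≠ 0 := hv.apply_ne_zero hm a
    refine ⟨w a / v a, ?_⟩
    by_contra h
    have hu := hμ.1.offAllSubset (v := w - (w a / v a) • v) (sub_ne_zero.2 h)
      (by simp [Finset.sum_sub_distrib, ← Finset.mul_sum, hw1, hv1])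
      (by simp [sub_smul, Finset.sum_sub_distrib, mul_smul, ← Finset.smul_sum, hw2, hv2])
    exact hu.apply_ne_zero hm a (by simp [ha])
  have hne : ∑ i, v i * ‖μ i‖ ^ 2 ≠ 0 := by
    intro h
    let a : Fin m := ⟨0, by omega⟩
    let b : Fin m := ⟨1, by omega⟩
    have hba : b ≠ a := by simp [a, b]
    refine hv.apply_ne_zero hm b (hμ.2.eq_zero_of_star_relation (c := fun _ => a)
      (fun _ => rfl) ?_ ?_ hba.symm)
    · rw [Finset.filter_ne]
      simp
    · rw [← Finset.sum_congr rfl fun i _ => (smul_sub _ _ _).symm, Finset.sum_sub_distrib,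
        ← Finset.sum_smul, hv1, zero_smul, sub_zero]
      refine Prod.ext ?_ ?_
      · simpa [Prod.fst_sum] using hv2
      · simpa [Prod.snd_sum] using h
  rcases hne.lt_or_gt with h | h
  · refine ⟨-v, ⟨by simp [hv1], fun I h1 h2 => by simpa using hv.2 I h1 h2⟩,
      by simp [hv2], fun w h1 h2 => ?_, by simpa using h⟩
    obtain ⟨t, rfl⟩ := hunique w h1 h2
    exact ⟨-t, by simp⟩
  · exact ⟨v, hv, hv2, hunique, h⟩

end Dependency

section Realization

variable {m : ℕ}

lemma IsDependency.exists_eq_inner_add {E : Type*} [NormedAddCommGroup E] [InnerProductSpace ℝ E]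
    [FiniteDimensional ℝ E] {μ : Fin m → E} {v : Fin m → ℝ} (h : IsDependency μ v)
    {z : Fin m → ℝ} (hz : ∑ i, v i * z i = 0) :
    ∃ (y : E) (t : ℝ), ∀ i, z i = inner ℝ y (μ i) + t := by
  let f : E × ℝ →ₗ[ℝ] EuclideanSpace ℝ (Fin m) :=
    (WithLp.linearEquiv 2 ℝ (Fin m → ℝ)).symm.toLinearMap ∘ₗ
      LinearMap.pi fun i => (innerₗ E (μ i)).coprod LinearMap.id
  have hf : ∀ y t i, f (y, t) i = inner ℝ y (μ i) + t := fun y t i => by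
    simp [f, real_inner_comm]
  have hmem : WithLp.toLp 2 z ∈ LinearMap.range f := by
    rw [← Submodule.orthogonal_orthogonal (LinearMap.range f), Submodule.mem_orthogonal]
    intro w hw
    rw [Submodule.mem_orthogonal'] at hw
    have hw' : ∀ y t, ∑ i, w i * (inner ℝ y (μ i) + t) = 0 := fun y t => by
      have := hw _ ⟨(y, t), rfl⟩
      simpa [PiLp.inner_apply, hf, mul_comm] using this
    have h1 : ∑ i, w i = 0 := by simpa using hw' 0 1
    have h2 : ∑ i, w i • μ i = 0 := by
      rw [← inner_self_eq_zero (𝕜 := ℝ), inner_sum]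
      simpa [inner_smul_right] using hw' (∑ i, w i • μ i) 0
    obtain ⟨t, ht⟩ := h.unique _ h1 h2
    have : ∀ i, w i = t * v i := fun i => congrFun ht i
    simp only [PiLp.inner_apply, this]
    simp only [RCLike.inner_apply, conj_trivial]
    rw [← mul_zero t, ← hz, Finset.mul_sum]
    exact Finset.sum_congr rfl fun i _ => by ring
  obtain ⟨⟨y, t⟩, hyt⟩ := hmem
  exact ⟨y, t, fun i => by rw [← hf, hyt]⟩

lemma IsDependency.sum_mul_norm_sub_sq {E : Type*} [NormedAddCommGroup E] [InnerProductSpace ℝ E]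
    {μ : Fin m → E} {v : Fin m → ℝ} (hv : OffAllSubset v) (h : IsDependency μ v) (y : E) :
    ∑ i, v i * ‖y - μ i‖ ^ 2 = ∑ i, v i * ‖μ i‖ ^ 2 := by
  have h1 : ∑ i, v i * inner ℝ y (μ i) = 0 := by
    have := congrArg (inner ℝ y) h.sum_smul
    simpa [inner_sum, inner_smul_right] using this
  have h2 : ∀ i, v i * ‖y - μ i‖ ^ 2 =
      v i * ‖y‖ ^ 2 - 2 * (v i * inner ℝ y (μ i)) + v i * ‖μ i‖ ^ 2 := fun i => by
    rw [norm_sub_sq_real]; ring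
  simp only [h2, Finset.sum_add_distrib, Finset.sum_sub_distrib, ← Finset.mul_sum,
    ← Finset.sum_mul, h1, hv.1]
  ring

lemma IsDependency.rankingPatternUF_eq (hm : 0 < m) {n : ℕ} {μ : Fin m → EuclideanSpace ℝ (Fin n)}
    {v : Fin m → ℝ} (hv : OffAllSubset v) (h : IsDependency μ v) :
    rankingPatternUF μ = patternOfSubsets (positiveSubsets v) := by
  ext σ
  rw [hv.mem_patternOfSubsets_iff hm]
  constructor
  · rintro ⟨y, hy⟩
    refine ⟨fun i => ‖y - μ i‖ ^ 2, fun k l hkl => ?_, ?_⟩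
    · exact pow_lt_pow_left₀ (hy k l hkl) (norm_nonneg _) two_ne_zero
    · rw [h.sum_mul_norm_sub_sq hv]
      exact h.pos
  · rintro ⟨x, hx, hpos⟩
    set a := (∑ i, v i * ‖μ i‖ ^ 2) / ∑ i, v i * x i with ha
    have ha0 : 0 < a := div_pos h.pos hpos
    obtain ⟨y, t, hyt⟩ := h.exists_eq_inner_add (z := fun i => a * x i - ‖μ i‖ ^ 2) (by
      simp only [mul_sub, Finset.sum_sub_distrib, mul_left_comm _ a, ← Finset.mul_sum]
      rw [ha, div_mul_cancel₀ _ hpos.ne', sub_self])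
    refine ⟨-(1 / 2 : ℝ) • y, fun k l hkl => ?_⟩
    have hd : ∀ i, ‖-(1 / 2 : ℝ) • y - μ i‖ ^ 2 = ‖-(1 / 2 : ℝ) • y‖ ^ 2 + a * x i - t := by
      intro i
      rw [norm_sub_sq_real, real_inner_smul_left]
      linarith [hyt i]
    refine lt_of_pow_lt_pow_left₀ 2 (norm_nonneg _) ?_
    rw [hd, hd]
    have : a * x (σ k) < a * x (σ l) := mul_lt_mul_of_pos_left (hx hkl) ha0
    linarith

lemma IsDependency.positiveSubsets_notMem {E : Type*} [NormedAddCommGroup E]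
    [InnerProductSpace ℝ E] {μ : Fin m → E} {v : Fin m → ℝ} (hv : OffAllSubset v)
    (h : IsDependency μ v) : positiveSubsets v ∉ Set.range properSubsetsContaining := by
  rintro ⟨i, hi⟩
  have hneg := apply_nonpos_of_positiveSubsets_eq hi.symm
  have h1 := h.sum_mul_norm_sub_sq hv (μ i)
  have h2 : ∑ j, v j * ‖μ i - μ j‖ ^ 2 ≤ 0 := by
    refine Finset.sum_nonpos fun j _ => ?_
    by_cases hj : j = i
    · simp [hj]
    · exact mul_nonpos_of_nonpos_of_nonneg (hneg j hj) (by positivity)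
  have := h.pos
  linarith

lemma OffAllSubset.exists_two_pos (hm : 2 ≤ m) {v : Fin m → ℝ} (hv : OffAllSubset v)
    (hP : positiveSubsets v ∉ Set.range properSubsetsContaining) :
    ∃ a b, a ≠ b ∧ 0 < v a ∧ 0 < v b := by
  obtain ⟨a, ha⟩ : ∃ a, 0 < v a := by
    by_contra! h
    have := (Finset.sum_eq_zero_iff_of_nonpos fun i _ => h i).1 hv.1 ⟨0, by omega⟩ (by simp)
    exact hv.apply_ne_zero hm _ this
  by_contra! h
  exact hP ⟨a, (hv.positiveSubsets_eq fun b hb => h a b hb.symm ha).symm⟩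

/-- If `v` has two positive entries, then the quadratic form `∑ vᵢ cᵢ²` takes a positive value on
the orthogonal complement of `1` and `v`. -/
lemma exists_pos_quadratic {v : Fin m → ℝ} (hv : ∑ i, v i = 0) {a b : Fin m} (hab : a ≠ b)
    (ha : 0 < v a) (hb : 0 < v b) :
    ∃ c : Fin m → ℝ, ∑ i, c i = 0 ∧ ∑ i, v i * c i = 0 ∧ 0 < ∑ i, v i * c i ^ 2 := by
  have hm : (m : ℝ) ≠ 0 := by
    have := a.pos
    positivity
  let d : Fin m → ℝ := Pi.single a (v a)⁻¹ - Pi.single b (v b)⁻¹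
  let t : ℝ := (∑ i, d i) / m
  have hd1 : ∑ i, v i * d i = 0 := by
    simp [d, mul_sub, Finset.sum_sub_distrib, Pi.single_apply, ha.ne', hb.ne']
  have hd2 : ∑ i, v i * d i ^ 2 = (v a)⁻¹ + (v b)⁻¹ := by
    have : ∀ i, v i * d i ^ 2 =
        (if i = a then (v a)⁻¹ else 0) + (if i = b then (v b)⁻¹ else 0) := by
      intro i
      by_cases h1 : i = a
      · subst h1
        simp [d, hab]
        field_simp
      · by_cases h2 : i = b
        · subst h2
          simp [d, h1]
          field_simp
        · simp [d, h1, h2]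
    simp [this, Finset.sum_add_distrib]
  refine ⟨fun i => d i - t, ?_, ?_, ?_⟩
  · simp only [Finset.sum_sub_distrib, Finset.sum_const, Finset.card_univ, Fintype.card_fin,
      nsmul_eq_mul, t]
    field_simp
    simp
  · simp [mul_sub, Finset.sum_sub_distrib, ← Finset.sum_mul, hd1, hv]
  · have : ∀ i, v i * (d i - t) ^ 2 = v i * d i ^ 2 - 2 * t * (v i * d i) + v i * t ^ 2 :=
      fun i => by ring
    simp only [this, Finset.sum_add_distrib, Finset.sum_sub_distrib, ← Finset.mul_sum,
      ← Finset.sum_mul, hd1, hd2, hv]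
    have := inv_pos.2 ha
    have := inv_pos.2 hb
    linarith

lemma exists_isDependency (hm : 2 ≤ m) {v : Fin m → ℝ} (hv : OffAllSubset v)
    (hP : positiveSubsets v ∉ Set.range properSubsetsContaining) :
    ∃ μ : Fin m → EuclideanSpace ℝ (Fin (m - 2)), IsDependency μ v := by
  classical
  obtain ⟨a, b, hab, ha, hb⟩ := hv.exists_two_pos hm hP
  obtain ⟨c, hc1, hcv, hcpos⟩ := exists_pos_quadratic hv.1 hab ha hb
  let one : EuclideanSpace ℝ (Fin m) := WithLp.toLp 2 fun _ => 1
  let v' : EuclideanSpace ℝ (Fin m) := WithLp.toLp 2 v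
  let c' : EuclideanSpace ℝ (Fin m) := WithLp.toLp 2 c
  let W : Submodule ℝ (EuclideanSpace ℝ (Fin m)) := Submodule.span ℝ (Set.range ![one, v'])
  have hone : ∀ w : EuclideanSpace ℝ (Fin m), inner ℝ one w = ∑ i, w i := fun w => by
    simp [one, PiLp.inner_apply]
  have hinner : ∀ w : EuclideanSpace ℝ (Fin m), inner ℝ v' w = ∑ i, v i * w i := fun w => by
    simp [v', PiLp.inner_apply, mul_comm]
  have hmemW : ∀ w : EuclideanSpace ℝ (Fin m), w ∈ W ↔ ∃ s t : ℝ, s • one + t • v' = w := by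
    intro w
    simp only [W, Matrix.range_cons, Matrix.range_empty, Set.union_empty, Set.singleton_union,
      Submodule.mem_span_pair]
  have hmemWo : ∀ w : EuclideanSpace ℝ (Fin m),
      ∑ i, w i = 0 → ∑ i, v i * w i = 0 → w ∈ Wᗮ := by
    intro w h1 h2
    rw [Submodule.mem_orthogonal]
    intro u hu
    obtain ⟨s, t, rfl⟩ := (hmemW u).1 hu
    rw [inner_add_left, real_inner_smul_left, real_inner_smul_left, hone, hinner, h1, h2]
    simp
  have hvsq : 0 < ∑ i, v i * v i := by
    refine Finset.sum_pos' (fun i _ => mul_self_nonneg _) ⟨a, by simp, by positivity⟩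
  have hind : LinearIndependent ℝ ![one, v'] := by
    rw [LinearIndependent.pair_iff]
    intro s t hst
    have h1 := congrArg (inner ℝ one) hst
    have h2 := congrArg (inner ℝ v') hst
    have hm0 : (m : ℝ) ≠ 0 := by positivity
    have hov : inner ℝ one v' = 0 := by rw [hone]; exact hv.1
    have hoo : inner ℝ one one = (m : ℝ) := by rw [hone]; simp [one]
    have hvv : inner ℝ v' v' = ∑ i, v i * v i := hinner v'
    rw [inner_add_right, real_inner_smul_right, real_inner_smul_right, hov, hoo,
      inner_zero_right] at h1
    rw [inner_add_right, real_inner_smul_right, real_inner_smul_right, real_inner_comm, hov, hvv,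
      inner_zero_right] at h2
    refine ⟨?_, ?_⟩
    · simpa [hm0] using h1
    · simpa [hvsq.ne'] using h2
  have hrank : Module.finrank ℝ Wᗮ = m - 2 := by
    have h1 := Submodule.finrank_add_finrank_orthogonal W
    have h2 : Module.finrank ℝ W = 2 := by simpa using finrank_span_eq_card hind
    rw [h2, finrank_euclideanSpace, Fintype.card_fin] at h1
    omega
  let iso : Wᗮ ≃ₗᵢ[ℝ] EuclideanSpace ℝ (Fin (m - 2)) :=
    ((stdOrthonormalBasis ℝ Wᗮ).reindex (finCongr hrank)).repr
  let P : EuclideanSpace ℝ (Fin m) →L[ℝ] Wᗮ := Wᗮ.orthogonalProjectionOnto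
  have hc' : c' ∈ Wᗮ := hmemWo c' hc1 hcv
  let cW : Wᗮ := ⟨c', hc'⟩
  let e : Fin m → EuclideanSpace ℝ (Fin m) := fun i => EuclideanSpace.single i 1
  have hcP : ∀ i, inner ℝ cW (P (e i)) = c i := by
    intro i
    have : inner ℝ cW (P (e i)) = inner ℝ c' (e i) :=
      Submodule.inner_orthogonalProjectionOnto_eq_of_mem_left cW (e i)
    rw [this, EuclideanSpace.inner_single_right]
    simp [c']
  have hsumP : ∀ w : Fin m → ℝ, ∑ i, w i • P (e i) = P (WithLp.toLp 2 w) := by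
    intro w
    have : WithLp.toLp 2 w = ∑ i, w i • e i := by
      ext j
      simp [e, Pi.single_apply]
    rw [this, map_sum]
    simp
  set A := ∑ i, v i * ‖P (e i)‖ ^ 2 with hA
  set B := ∑ i, v i * c i ^ 2 with hB
  obtain ⟨s, hs0, hs⟩ : ∃ s : ℝ, 0 ≤ s ∧ 0 < A + 2 * s * B := by
    refine ⟨(|A| + 1) / B, by positivity, ?_⟩
    have : 2 * ((|A| + 1) / B) * B = 2 * (|A| + 1) := by field_simp
    rw [this]
    linarith [neg_abs_le A, abs_nonneg A]
  let T : Wᗮ →ₗ[ℝ] Wᗮ := LinearMap.id + s • (innerₗ Wᗮ cW).smulRight cW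
  have hT : ∀ x, T x = x + (s * inner ℝ cW x) • cW := fun x => by simp [T, mul_smul]
  have hTnorm : ∀ x, ‖T x‖ ^ 2 = ‖x‖ ^ 2 + (2 * s + s ^ 2 * ‖cW‖ ^ 2) * inner ℝ cW x ^ 2 := by
    intro x
    rw [hT, norm_add_sq_real, real_inner_smul_right, norm_smul, real_inner_comm, mul_pow,
      Real.norm_eq_abs, sq_abs]
    ring
  have hTinj : ∀ x, T x = 0 → x = 0 := by
    intro x hx
    have h1 := hTnorm x
    rw [hx, norm_zero] at h1
    have h2 : 0 ≤ (2 * s + s ^ 2 * ‖cW‖ ^ 2) * inner ℝ cW x ^ 2 := by positivity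
    have h3 : ‖x‖ ^ 2 = 0 := le_antisymm (by linarith) (by positivity)
    simpa using h3
  have hsumμ : ∀ w : Fin m → ℝ, ∑ i, w i • iso (T (P (e i))) = iso (T (P (WithLp.toLp 2 w))) := by
    intro w
    rw [← hsumP]
    simp
  refine ⟨fun i => iso (T (P (e i))), ?_, ?_, ?_⟩
  · rw [hsumμ]
    have : P (WithLp.toLp 2 v) = 0 := by
      rw [Submodule.orthogonalProjectionOnto_eq_zero_iff, Submodule.orthogonal_orthogonal]
      exact (hmemW _).2 ⟨0, 1, by simp [v']⟩
    simp [this]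
  · intro w hw1 hw2
    rw [hsumμ] at hw2
    have hPw : P (WithLp.toLp 2 w) = 0 := hTinj _ (by simpa using hw2)
    rw [Submodule.orthogonalProjectionOnto_eq_zero_iff, Submodule.orthogonal_orthogonal,
      hmemW] at hPw
    obtain ⟨r, t, hrt⟩ := hPw
    have hwi : ∀ i, w i = r + t * v i := fun i => by
      have := congrArg (fun x : EuclideanSpace ℝ (Fin m) => x i) hrt
      simpa [one, v'] using this.symm
    have hr : r = 0 := by
      have hm0 : (m : ℝ) ≠ 0 := by positivity
      simpa [hwi, Finset.sum_add_distrib, ← Finset.mul_sum, hv.1, hm0] using hw1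
    exact ⟨t, funext fun i => by simp [hwi, hr]⟩
  · have : ∀ i, v i * ‖iso (T (P (e i)))‖ ^ 2 =
        v i * ‖P (e i)‖ ^ 2 + (2 * s + s ^ 2 * ‖cW‖ ^ 2) * (v i * c i ^ 2) := fun i => by
      rw [LinearIsometryEquiv.norm_map, hTnorm, hcP]
      ring
    simp only [this, Finset.sum_add_distrib, ← Finset.mul_sum]
    have : 0 ≤ s ^ 2 * ‖cW‖ ^ 2 * B := by positivity
    linarith

lemma rankingPatternsUF_eq_image (hm : 2 ≤ m) :
    {R : Set (Equiv.Perm (Fin m)) |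
        ∃ μ : Fin m → EuclideanSpace ℝ (Fin (m - 2)), Generic μ ∧ R = rankingPatternUF μ} =
      patternOfSubsets '' (positiveSubsets '' {v : Fin m → ℝ | OffAllSubset v} \
        Set.range properSubsetsContaining) := by
  ext R
  constructor
  · rintro ⟨μ, hμ, rfl⟩
    obtain ⟨v, hv, h⟩ := hμ.exists_isDependency hm
    exact ⟨_, ⟨⟨v, hv, rfl⟩, h.positiveSubsets_notMem hv⟩,
      (h.rankingPatternUF_eq (by omega) hv).symm⟩
  · rintro ⟨_, ⟨⟨v, hv, rfl⟩, hP⟩, rfl⟩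
    obtain ⟨μ, h⟩ := exists_isDependency hm hv hP
    exact ⟨μ, h.generic hm hv, (h.rankingPatternUF_eq (by omega) hv).symm⟩

end Realization


/-- Theorem 5.2: the number `q(m)` of ranking patterns of unfolding models of
codimension one equals the number of chambers of the restriction `A⁰` of the
all-subset arrangement to `H0` (the number of connected components of the
complement), minus `m`. -/
theorem card_rankingPatternsUF {m : ℕ} (hm : 3 ≤ m) :
    {R : Set (Equiv.Perm (Fin m)) |
        ∃ μ : Fin m → EuclideanSpace ℝ (Fin (m - 2)),
          Generic μ ∧ R = rankingPatternUF μ}.ncard =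
      Nat.card (ConnectedComponents
        {x : EuclideanSpace ℝ (Fin m) // (∑ i, x i = 0) ∧
          ∀ I : Finset (Fin m), I.Nonempty → I ≠ Finset.univ →
            ∑ i ∈ I, x i ≠ 0}) - m := by
  change _ = Nat.card
    (ConnectedComponents {x : EuclideanSpace ℝ (Fin m) // OffAllSubset x}) - m
  have hT : Set.range properSubsetsContaining ⊆
      positiveSubsets '' {v : Fin m → ℝ | OffAllSubset v} := by
    rintro _ ⟨i, rfl⟩
    obtain ⟨v, hv, h⟩ := exists_positiveSubsets_eq i
    exact ⟨v, hv, h⟩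
  have hcard : (Set.range (properSubsetsContaining (m := m))).ncard = m := by
    rw [← Nat.card_coe_set_eq, Nat.card_range_of_injective
      (properSubsetsContaining_injective (by omega)), Nat.card_fin]
  rw [rankingPatternsUF_eq_image (by omega),
    (injOn_patternOfSubsets.mono Set.sdiff_subset).ncard_image,
    Set.ncard_sdiff hT, hcard, card_connectedComponents_offAllSubset]
end
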